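/- arXiv:math/0611538 — 2 statements merged into one kernel-verified Lean document; each statement's English description precedes it below -/
import Mathlib

section
/- Let P be a probability measure on Ω = ∏_{n≥1} {1,…,n} such that for every n the cylinder probability P(ω_1 = i_1, …, ω_n = i_n) depends on (i_1,…,i_n) only through #{2 ≤ j ≤ n : i_j ∈ {1, j}} (equivalently, each random permutation π_n is conditionally uniform given its total number of records). For η ∈ (0,∞) let R^η be the probability measure on Ω under which the coordinates are independent, ω_1 = 1, ω_2 is uniform on {1,2}, and for n ≥ 3: R^η(ω_n = 1) = R^η(ω_n = n) = (η/2)/(η+n−2) and R^η(ω_n = r) = 1/(η+n−2) for 2 ≤ r ≤ n−1; let R^0 be the measure with ω_1 = 1, ω_2 uniform on {1,2}, and ω_n uniform on {2,…,n−1} for n ≥ 3; and let R^∞ be the measure with ω_1 = 1 and ω_n uniform on {1,n} for n ≥ 2. Then there exists a unique probability measure ν on [0,∞] such that P(E) = ∫_{[0,∞]} R^η(E) dν(η) for every cylinder event E. -/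
open MeasureTheory ENNReal

/-- the space `Ω = ∏_{n≥1} {1,…,n}` of sequences of initial ranks: the coordinate of
index `k` (0-based) encodes `ω_{k+1} ∈ {1,…,k+1}` as an element of `Fin (k+1)`
(value `v` encodes rank `v+1`; rank `1`, i.e. `v = 0`, marks a lower record and
rank `k+1`, i.e. `v = k`, marks an upper record). -/
abbrev RankSpace := (k : ℕ) → Fin (k + 1)

/-- cylinder event `{ω_1 = i_1, …, ω_n = i_n}` -/
def rankCyl {n : ℕ} (i : (j : Fin n) → Fin (j.val + 1)) : Set RankSpace :=
  {ω | ∀ j : Fin n, ω j.val = i j}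

/-- the `R^η`-probability (`η ∈ [0,∞]`) that the coordinate of index `j` equals `v`
(`j = 1` encodes `ω_2`, uniform on `{1,2}`; `j ≥ 2` encodes `ω_n` with `n = j+1 ≥ 3`:
each extreme rank has probability `(η/2)/(η+n−2)` and each middle rank `1/(η+n−2)`;
`R^0` is uniform on the middle ranks and `R^∞` uniform on the two extreme ranks). -/
noncomputable def symWt (η : ℝ≥0∞) (j : ℕ) (v : Fin (j + 1)) : ℝ≥0∞ :=
  if j = 0 then 1
  else if j = 1 then 1 / 2
  else if η = 0 then
    (if v.val = 0 ∨ v.val = j then 0 else 1 / ((j - 1 : ℕ) : ℝ≥0∞))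
  else if η = ⊤ then
    (if v.val = 0 ∨ v.val = j then 1 / 2 else 0)
  else
    (if v.val = 0 ∨ v.val = j then (η / 2) / (η + ((j - 1 : ℕ) : ℝ≥0∞))
     else 1 / (η + ((j - 1 : ℕ) : ℝ≥0∞)))

open unitInterval in
/-- Probability measures on `[0,1]` are determined by their moments. -/
theorem unitInterval_measure_ext_of_moments {μ ν : Measure I} [IsProbabilityMeasure μ]
    [IsProbabilityMeasure ν]
    (h : ∀ k : ℕ, ∫ x : I, (x : ℝ) ^ k ∂μ = ∫ x : I, (x : ℝ) ^ k ∂ν) : μ = ν := by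
  have hint : ∀ (ρ : Measure I) [IsProbabilityMeasure ρ] (f : C(I, ℝ)), Integrable f ρ :=
    fun ρ _ f => f.continuous.integrable_of_hasCompactSupport (HasCompactSupport.of_compactSpace f)
  have hcont : ∀ (ρ : Measure I) [IsProbabilityMeasure ρ],
      Continuous fun f : C(I, ℝ) => ∫ x, f x ∂ρ := by
    intro ρ _
    refine LipschitzWith.continuous (K := 1) (LipschitzWith.of_dist_le_mul fun f g => ?_)
    rw [Real.dist_eq, ← integral_sub (hint ρ f) (hint ρ g), ← Real.norm_eq_abs]
    refine (norm_integral_le_of_norm_le_const (C := dist f g)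
      (Filter.Eventually.of_forall fun x => ?_)).trans (by simp)
    rw [← dist_eq_norm]
    exact ContinuousMap.dist_apply_le_dist x
  have hclosed : IsClosed {f : C(I, ℝ) | ∫ x, f x ∂μ = ∫ x, f x ∂ν} :=
    isClosed_eq (hcont μ) (hcont ν)
  have hpoly : (polynomialFunctions I : Set C(I, ℝ)) ⊆
      {f : C(I, ℝ) | ∫ x, f x ∂μ = ∫ x, f x ∂ν} := by
    rw [polynomialFunctions_coe]
    rintro _ ⟨p, rfl⟩
    induction p using Polynomial.induction_on' with
    | add p q hp hq =>
      simp only [Set.mem_ofPred_eq, map_add, ContinuousMap.add_apply] at hp hq ⊢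
      rw [integral_add (hint μ _) (hint μ _), integral_add (hint ν _) (hint ν _), hp, hq]
    | monomial n a =>
      simp only [Set.mem_ofPred_eq, Polynomial.toContinuousMapOnAlgHom_apply,
        Polynomial.toContinuousMapOn_apply, Polynomial.toContinuousMap_apply,
        Polynomial.eval_monomial, integral_const_mul, h n]
  refine ext_of_forall_integral_eq_of_IsFiniteMeasure fun f => ?_
  have hf : f.toContinuousMap ∈ closure (polynomialFunctions I : Set C(I, ℝ)) := by
    have := polynomialFunctions_closure_eq_top'
    rw [← Subalgebra.topologicalClosure_coe, this]
    trivial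
  exact closure_minimal hpoly hclosed hf

/-- The map `η ↦ 1 / (1 + η)` from `[0,∞]` to `[0,1]`. -/
noncomputable def squash (η : ℝ≥0∞) : unitInterval :=
  ⟨((1 + η)⁻¹).toReal, ENNReal.toReal_nonneg,
    ENNReal.toReal_le_of_le_ofReal zero_le_one (by simp)⟩

theorem squash_injective : Function.Injective squash := by
  intro a b hab
  have h := congrArg Subtype.val hab
  simp only [squash] at h
  rw [ENNReal.toReal_eq_toReal_iff' (by simp) (by simp)] at h
  exact (ENNReal.add_right_inj one_ne_top).1 (inv_injective h)

theorem continuous_squash : Continuous squash := by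
  refine Continuous.subtype_mk ?_ _
  refine ENNReal.continuousOn_toReal.comp_continuous (by fun_prop) fun x => ?_
  simp

theorem squash_top : (squash ⊤ : ℝ) = 0 := by simp [squash]

theorem squash_zero : (squash 0 : ℝ) = 1 := by simp [squash]

theorem squash_of_ne_top {η : ℝ≥0∞} (hη : η ≠ ⊤) :
    (squash η : ℝ) = 1 / (1 + η.toReal) := by
  simp [squash, ENNReal.toReal_inv, ENNReal.toReal_add one_ne_top hη]

theorem integral_unitInterval_rpow {a : ℝ} (ha : 0 ≤ a) :
    ∫ u : unitInterval, (u : ℝ) ^ a = 1 / (1 + a) := by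
  have h := unitInterval.measurePreserving_coe.integral_comp
    (MeasurableEmbedding.subtype_coe measurableSet_Icc) (fun x : ℝ => x ^ a)
  rw [h, integral_Icc_eq_integral_Ioc, ← intervalIntegral.integral_of_le zero_le_one,
    integral_rpow (Or.inl (by linarith)), Real.one_rpow, Real.zero_rpow (by linarith)]
  rw [add_comm a 1, sub_zero]

theorem volume_rpow_le {y : ℝ} (hy : 0 ≤ y) {j : ℕ} (hj : j ≠ 0) :
    volume {u : unitInterval | (u : ℝ) ^ y ≤ Real.exp (-j)} =
      ENNReal.ofReal (expNegInvGlue y ^ j) := by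
  have hj' : (0 : ℝ) < j := by positivity
  rcases hy.eq_or_lt with rfl | hy
  · simp [hj]
  · have he : ∀ u : unitInterval, (u : ℝ) ^ y ≤ Real.exp (-j) ↔
        u ∈ Set.Iic (⟨expNegInvGlue y ^ j, pow_nonneg (expNegInvGlue.nonneg y) j,
          pow_le_one₀ (expNegInvGlue.nonneg y) (by
            simp only [expNegInvGlue, hy.not_ge, if_false]
            exact Real.exp_le_one_iff.2 (by simpa using hy.le))⟩ : unitInterval) := by
      intro u
      rw [Set.mem_Iic, ← Subtype.coe_le_coe]
      simp only [expNegInvGlue, hy.not_ge, if_false]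
      rw [← Real.exp_nat_mul, ← Real.le_rpow_inv_iff_of_pos u.2.1 (Real.exp_nonneg _) hy,
        ← Real.exp_mul, neg_mul, mul_neg]
    simp_rw [he]
    exact unitInterval.volume_Iic _

theorem measure_ext_of_integral_squash {μ ν : Measure ℝ≥0∞} [IsProbabilityMeasure μ]
    [IsProbabilityMeasure ν]
    (h : ∀ k : ℕ, ∫ η, 1 / (1 + k * (squash η : ℝ)) ∂μ = ∫ η, 1 / (1 + k * (squash η : ℝ)) ∂ν) :
    μ = ν := by
  have hsq : Measurable fun η => (squash η : ℝ) :=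
    (continuous_subtype_val.comp continuous_squash).measurable
  let T : ℝ≥0∞ × unitInterval → unitInterval := fun p =>
    ⟨(p.2 : ℝ) ^ (squash p.1 : ℝ), Real.rpow_nonneg p.2.2.1 _,
      Real.rpow_le_one p.2.2.1 p.2.2.2 (squash p.1).2.1⟩
  have hT : Measurable T := by
    refine Measurable.subtype_mk ?_
    exact (measurable_subtype_coe.comp measurable_snd).pow (hsq.comp measurable_fst)
  have hmom : ∀ (ρ : Measure ℝ≥0∞) [IsProbabilityMeasure ρ] (k : ℕ),
      ∫ x : unitInterval, (x : ℝ) ^ k ∂((ρ.prod volume).map T)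
        = ∫ η, 1 / (1 + k * (squash η : ℝ)) ∂ρ := by
    intro ρ _ k
    rw [integral_map hT.aemeasurable (by fun_prop), integral_prod]
    · refine integral_congr_ae (Filter.Eventually.of_forall fun η => ?_)
      simp only [T]
      rw [← integral_unitInterval_rpow (mul_nonneg k.cast_nonneg (squash η).2.1)]
      refine integral_congr_ae (Filter.Eventually.of_forall fun u => ?_)
      simp only
      rw [← Real.rpow_natCast, ← Real.rpow_mul u.2.1, mul_comm]
    · refine Integrable.of_bound (C := 1) (Measurable.aestronglyMeasurable ?_)
        (Filter.Eventually.of_forall fun p => ?_)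
      · exact (measurable_subtype_coe.comp hT).pow_const k
      · rw [Real.norm_of_nonneg (pow_nonneg (T p).2.1 k)]
        exact pow_le_one₀ (T p).2.1 (T p).2.2
  have hmap : (μ.prod volume).map T = (ν.prod volume).map T := by
    have := Measure.isProbabilityMeasure_map (μ := μ.prod volume) hT.aemeasurable
    have := Measure.isProbabilityMeasure_map (μ := ν.prod volume) hT.aemeasurable
    refine unitInterval_measure_ext_of_moments fun k => ?_
    rw [hmom, hmom, h]
  let Z : ℝ≥0∞ → unitInterval := fun η => ⟨expNegInvGlue (squash η), expNegInvGlue.nonneg _, by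
    refine (expNegInvGlue.monotone (squash η).2.2).trans ?_
    simp [expNegInvGlue, not_le.2 (zero_lt_one' ℝ)]⟩
  have hZ : Measurable Z :=
    Measurable.subtype_mk ((expNegInvGlue.contDiff (n := 0)).continuous.measurable.comp hsq)
  have hZinj : Function.Injective Z := by
    intro a b hab
    have h1 : expNegInvGlue (squash a) = expNegInvGlue (squash b) := congrArg Subtype.val hab
    apply squash_injective
    apply Subtype.ext
    have ha := (squash a).2.1
    have hb := (squash b).2.1
    rcases ha.eq_or_lt with ha | ha
    · rw [← ha, expNegInvGlue.zero, eq_comm, expNegInvGlue.zero_iff_nonpos] at h1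
      linarith
    · rcases hb.eq_or_lt with hb | hb
      · rw [← hb, expNegInvGlue.zero, expNegInvGlue.zero_iff_nonpos] at h1
        linarith
      · simpa [expNegInvGlue, ha.not_ge, hb.not_ge] using h1
  have hcdf : ∀ (ρ : Measure ℝ≥0∞) [IsProbabilityMeasure ρ] (j : ℕ), j ≠ 0 →
      ∫ x : unitInterval, (x : ℝ) ^ j ∂(ρ.map Z) =
        ((ρ.prod volume).map T {u | (u : ℝ) ≤ Real.exp (-j)}).toReal := by
    intro ρ _ j hj
    have hS : MeasurableSet {u : unitInterval | (u : ℝ) ≤ Real.exp (-j)} :=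
      measurableSet_le (by fun_prop) (by fun_prop)
    rw [Measure.map_apply hT hS, Measure.prod_apply (hT hS),
      integral_map hZ.aemeasurable (by fun_prop), integral_eq_lintegral_of_nonneg_ae]
    · congr 1
      refine lintegral_congr fun η => ?_
      exact (volume_rpow_le (squash η).2.1 hj).symm
    · exact Filter.Eventually.of_forall fun η => pow_nonneg (Z η).2.1 j
    · exact ((measurable_subtype_coe.comp hZ).pow_const j).aestronglyMeasurable
  have hZmap : μ.map Z = ν.map Z := by
    have := Measure.isProbabilityMeasure_map (μ := μ) hZ.aemeasurable
    have := Measure.isProbabilityMeasure_map (μ := ν) hZ.aemeasurable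
    refine unitInterval_measure_ext_of_moments fun k => ?_
    rcases eq_or_ne k 0 with rfl | hk
    · simp
    · rw [hcdf μ k hk, hcdf ν k hk, hmap]
  have hemb := hZ.measurableEmbedding hZinj
  rw [← hemb.comap_map μ, ← hemb.comap_map ν, hZmap]

/-- The partial harmonic sum `1/(n+1) + ⋯ + 1/(n+L)`. -/
noncomputable def harmonicFrom (n L : ℕ) : ℝ := ∑ i ∈ Finset.range L, 1 / ((n + i + 1 : ℕ) : ℝ)

/-- The elementary symmetric polynomial of degree `s` in `1/(n+1), …, 1/(n+L)`. -/
noncomputable def esymmFrom (n : ℕ) : ℕ → ℕ → ℝ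
  | 0, 0 => 1
  | 0, _ + 1 => 0
  | L + 1, 0 => esymmFrom n L 0
  | L + 1, s + 1 => esymmFrom n L (s + 1) + esymmFrom n L s / ((n + L + 1 : ℕ) : ℝ)

theorem harmonicFrom_nonneg (n L : ℕ) : 0 ≤ harmonicFrom n L :=
  Finset.sum_nonneg fun _ _ => by positivity

theorem harmonicFrom_succ (n L : ℕ) :
    harmonicFrom n (L + 1) = harmonicFrom n L + 1 / ((n + L + 1 : ℕ) : ℝ) :=
  Finset.sum_range_succ _ _

theorem harmonicFrom_mono (n : ℕ) : Monotone (harmonicFrom n) :=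
  monotone_nat_of_le_succ fun L => by
    rw [harmonicFrom_succ]
    exact le_add_of_nonneg_right (by positivity)

theorem harmonicFrom_zero_add (n L : ℕ) :
    harmonicFrom 0 (n + L) = harmonicFrom 0 n + harmonicFrom n L := by
  simp [harmonicFrom, Finset.sum_range_add]

theorem harmonicFrom_le_two_mul_sqrt (M : ℕ) : harmonicFrom 0 M ≤ 2 * √(M : ℝ) := by
  induction M with
  | zero => simp [harmonicFrom]
  | succ M ih =>
    rw [harmonicFrom_succ]
    have h0 : (0 : ℝ) ≤ M := M.cast_nonneg
    have ha := Real.sq_sqrt h0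
    have hb := Real.sq_sqrt (by positivity : (0 : ℝ) ≤ M + 1)
    have hb0 : 0 < √((M : ℝ) + 1) := Real.sqrt_pos.2 (by positivity)
    have ha0 := Real.sqrt_nonneg (M : ℝ)
    push_cast
    rw [zero_add]
    have : 1 / ((M : ℝ) + 1) ≤ 2 * (√((M : ℝ) + 1) - √(M : ℝ)) := by
      rw [div_le_iff₀ (by positivity)]
      have hab : √(M : ℝ) ≤ √((M : ℝ) + 1) := Real.sqrt_le_sqrt (by linarith)
      have h1 : 1 ≤ √((M : ℝ) + 1) := by rw [Real.one_le_sqrt]; linarith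
      have hd : (√((M : ℝ) + 1) - √(M : ℝ)) * (√((M : ℝ) + 1) + √(M : ℝ)) = 1 := by nlinarith
      nlinarith [mul_nonneg (sub_nonneg.2 hab) (mul_nonneg hb0.le (sub_nonneg.2 h1)),
        mul_nonneg (sub_nonneg.2 hab) (sub_nonneg.2 hab)]
    linarith

theorem tendsto_harmonicFrom : Filter.Tendsto (harmonicFrom 0) Filter.atTop Filter.atTop := by
  refine Real.tendsto_sum_range_one_div_nat_succ_atTop.congr fun n => ?_
  simp [harmonicFrom]

theorem esymmFrom_nonneg (n L s : ℕ) : 0 ≤ esymmFrom n L s := by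
  induction L generalizing s with
  | zero => cases s <;> simp [esymmFrom]
  | succ L ih =>
    cases s with
    | zero => exact ih 0
    | succ s =>
      have := ih s
      have := ih (s + 1)
      rw [esymmFrom]
      positivity

theorem esymmFrom_eq_zero {n L s : ℕ} (h : L < s) : esymmFrom n L s = 0 := by
  induction L generalizing s with
  | zero => obtain ⟨s, rfl⟩ := Nat.exists_eq_add_of_lt h; simp [esymmFrom]
  | succ L ih =>
    cases s with
    | zero => omega
    | succ s => rw [esymmFrom, ih (by omega), ih (by omega)]; simp

theorem esymmFrom_zero (n L : ℕ) : esymmFrom n L 0 = 1 := by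
  induction L with
  | zero => rfl
  | succ L ih => exact ih

theorem esymmFrom_succ_succ (n L s : ℕ) :
    esymmFrom n (L + 1) (s + 1) =
      esymmFrom (n + 1) L (s + 1) + esymmFrom (n + 1) L s / ((n + 1 : ℕ) : ℝ) := by
  induction L generalizing s with
  | zero => cases s <;> simp [esymmFrom]
  | succ L ih =>
    rw [esymmFrom, ih]
    cases s with
    | zero =>
      simp only [esymmFrom, esymmFrom_zero]
      rw [show n + (L + 1) + 1 = n + 1 + L + 1 by omega]
      ring
    | succ s =>
      rw [ih, esymmFrom, esymmFrom, show n + (L + 1) + 1 = n + 1 + L + 1 by omega]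
      ring

theorem esymmFrom_succ (n L s : ℕ) :
    esymmFrom n (L + 1) (s + 1) =
      esymmFrom n L (s + 1) + 1 / ((n + L + 1 : ℕ) : ℝ) * esymmFrom n L s := by
  rw [esymmFrom, div_eq_mul_one_div, mul_comm (esymmFrom n L s)]

theorem succ_mul_esymmFrom_succ_le (n L s : ℕ) :
    (s + 1) * esymmFrom n L (s + 1) ≤ harmonicFrom n L * esymmFrom n L s := by
  induction L generalizing s with
  | zero => simp [esymmFrom, harmonicFrom]
  | succ L ih =>
    have hk : (0 : ℝ) ≤ 1 / ((n + L + 1 : ℕ) : ℝ) := by positivity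
    cases s with
    | zero =>
      have := ih 0
      rw [harmonicFrom_succ, esymmFrom_succ, esymmFrom_zero, esymmFrom_zero] at *
      push_cast at this ⊢
      linarith
    | succ s =>
      have h1 := ih (s + 1)
      have h2 := mul_le_mul_of_nonneg_left (ih s) hk
      have h3 := mul_nonneg (mul_nonneg hk hk) (esymmFrom_nonneg n L s)
      rw [harmonicFrom_succ, esymmFrom_succ, esymmFrom_succ]
      generalize 1 / ((n + L + 1 : ℕ) : ℝ) = c at *
      push_cast at *
      linarith

theorem le_succ_mul_esymmFrom_succ (n L s : ℕ) :
    (harmonicFrom n L - harmonicFrom 0 s) * esymmFrom n L s ≤ (s + 1) * esymmFrom n L (s + 1) := by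
  induction L generalizing s with
  | zero =>
    cases s with
    | zero => simp [esymmFrom, harmonicFrom]
    | succ s => simp [esymmFrom]
  | succ L ih =>
    have hc : 0 ≤ 1 / ((n + L + 1 : ℕ) : ℝ) := by positivity
    cases s with
    | zero =>
      have := ih 0
      simp only [esymmFrom_succ, harmonicFrom_succ, esymmFrom_zero, CharP.cast_eq_zero] at this ⊢
      linarith
    | succ s =>
      have h1 := ih (s + 1)
      have h2 := mul_le_mul_of_nonneg_left (ih s) hc
      have h3 : 1 / ((n + L + 1 : ℕ) : ℝ) * esymmFrom n L s ≤
          1 / ((0 + s + 1 : ℕ) : ℝ) * esymmFrom n L s := by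
        rcases lt_or_ge L s with hs | hs
        · simp [esymmFrom_eq_zero hs]
        · refine mul_le_mul_of_nonneg_right ?_ (esymmFrom_nonneg n L s)
          exact one_div_le_one_div_of_le (by positivity) (by exact_mod_cast (by omega))
      have h4 := mul_le_mul_of_nonneg_left h3 hc
      rw [harmonicFrom_succ 0 s] at h1 ⊢
      rw [harmonicFrom_succ n L, esymmFrom_succ, esymmFrom_succ]
      generalize 1 / ((n + L + 1 : ℕ) : ℝ) = c at *
      generalize 1 / ((0 + s + 1 : ℕ) : ℝ) = d at *
      push_cast at *
      linarith

/-- The total normalised weight of the paths from `(n, m)` to `(N, M)`. -/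
noncomputable def pathWeight (n m N M : ℕ) : ℝ :=
  if M < m then 0 else esymmFrom n (N - n) (M - m)

theorem pathWeight_nonneg (n m N M : ℕ) : 0 ≤ pathWeight n m N M := by
  unfold pathWeight
  split_ifs
  exacts [le_rfl, esymmFrom_nonneg _ _ _]

theorem pathWeight_self (m N M : ℕ) : pathWeight N m N M = if M = m then 1 else 0 := by
  unfold pathWeight
  rw [Nat.sub_self]
  rcases lt_trichotomy M m with h | rfl | h
  · simp [h, h.ne]
  · simp [esymmFrom]
  · obtain ⟨d, rfl⟩ := Nat.exists_eq_add_of_lt h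
    rw [if_neg (by omega), if_neg (by omega), show m + d + 1 - m = d + 1 by omega, esymmFrom]

theorem pathWeight_eq_add {n N : ℕ} (h : n < N) (m M : ℕ) :
    pathWeight n m N M =
      pathWeight (n + 1) m N M + pathWeight (n + 1) (m + 1) N M / ((n + 1 : ℕ) : ℝ) := by
  obtain ⟨L, rfl⟩ := Nat.exists_eq_add_of_lt h
  unfold pathWeight
  rw [show n + L + 1 - n = L + 1 by omega, show n + L + 1 - (n + 1) = L by omega]
  rcases lt_trichotomy M m with h | rfl | h
  · rw [if_pos h, if_pos h, if_pos (by omega)]; simp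
  · simp [esymmFrom_zero]
  · obtain ⟨d, rfl⟩ := Nat.exists_eq_add_of_lt h
    rw [if_neg (by omega), if_neg (by omega), if_neg (by omega),
      show m + d + 1 - m = d + 1 by omega, show m + d + 1 - (m + 1) = d by omega,
      esymmFrom_succ_succ]

theorem sub_mul_pathWeight_le {n N : ℕ} (h : n ≤ N) (m M : ℕ) :
    ((M : ℝ) - m) * pathWeight n m N M ≤ harmonicFrom 0 N * pathWeight n (m + 1) N M := by
  obtain ⟨L, rfl⟩ := Nat.exists_eq_add_of_le h
  unfold pathWeight
  rw [show n + L - n = L by omega]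
  rcases lt_trichotomy M m with h | rfl | h
  · rw [if_pos h, if_pos (by omega)]; simp
  · simp
  · obtain ⟨d, rfl⟩ := Nat.exists_eq_add_of_lt h
    rw [if_neg (by omega), if_neg (by omega),
      show m + d + 1 - m = d + 1 by omega, show m + d + 1 - (m + 1) = d by omega,
      harmonicFrom_zero_add]
    have h1 := succ_mul_esymmFrom_succ_le n L d
    have h2 := mul_nonneg (harmonicFrom_nonneg 0 n) (esymmFrom_nonneg n L d)
    push_cast
    linarith

theorem le_mul_pathWeight {n N : ℕ} (h : n ≤ N) (m M : ℕ) :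
    (harmonicFrom 0 N - harmonicFrom 0 n - harmonicFrom 0 M) * pathWeight n (m + 1) N M ≤
      M * pathWeight n m N M := by
  obtain ⟨L, rfl⟩ := Nat.exists_eq_add_of_le h
  unfold pathWeight
  rw [show n + L - n = L by omega]
  rcases lt_trichotomy M m with h | rfl | h
  · rw [if_pos h, if_pos (by omega)]; simp
  · simp [esymmFrom_zero]
  · obtain ⟨d, rfl⟩ := Nat.exists_eq_add_of_lt h
    rw [if_neg (by omega), if_neg (by omega),
      show m + d + 1 - m = d + 1 by omega, show m + d + 1 - (m + 1) = d by omega,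
      harmonicFrom_zero_add]
    have h1 := le_succ_mul_esymmFrom_succ n L d
    have h2 := mul_le_mul_of_nonneg_right
      (harmonicFrom_mono 0 (by omega : d ≤ m + d + 1)) (esymmFrom_nonneg n L d)
    have h3 := mul_nonneg m.cast_nonneg (α := ℝ) (esymmFrom_nonneg n L (d + 1))
    push_cast
    linarith

/-- The density `n! η ^ m / ((η + 1) ⋯ (η + n))`, as a function of `y = 1 / (1 + η)`. -/
noncomputable def mixKernel (n m : ℕ) (y : ℝ) : ℝ :=
  n.factorial * (1 - y) ^ m * y ^ (n - m) / ∏ j ∈ Finset.range n, (1 + j * y)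

theorem mixKernel_succ_left {n m : ℕ} (h : m ≤ n) (y : ℝ) :
    mixKernel (n + 1) m y = mixKernel n m y * ((n + 1) * y / (1 + n * y)) := by
  rw [mixKernel, mixKernel, Finset.prod_range_succ, div_mul_div_comm, Nat.factorial_succ,
    Nat.succ_sub h, pow_succ]
  push_cast
  ring

theorem mixKernel_succ_succ (n m : ℕ) (y : ℝ) :
    mixKernel (n + 1) (m + 1) y = mixKernel n m y * ((n + 1) * (1 - y) / (1 + n * y)) := by
  rw [mixKernel, mixKernel, Finset.prod_range_succ, div_mul_div_comm, Nat.factorial_succ,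
    Nat.succ_sub_succ, pow_succ]
  push_cast
  ring

theorem continuous_mixKernel_squash (n m : ℕ) :
    Continuous fun η => mixKernel n m (squash η) := by
  have h : Continuous fun η => (squash η : ℝ) := continuous_subtype_val.comp continuous_squash
  unfold mixKernel
  refine Continuous.div (by fun_prop) (by fun_prop) fun η => ?_
  exact (Finset.prod_pos fun j _ => by
    have := (squash η).2.1
    positivity).ne'

theorem mixKernel_squash_nonneg (n m : ℕ) (η : ℝ≥0∞) : 0 ≤ mixKernel n m (squash η) := by
  have h0 := (squash η).2.1
  have h1 := sub_nonneg.2 (squash η).2.2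
  unfold mixKernel
  have : 0 ≤ ∏ j ∈ Finset.range n, (1 + j * (squash η : ℝ)) :=
    Finset.prod_nonneg fun j _ => by positivity
  positivity

theorem abs_pathWeight_succ_sub_le {n N : ℕ} (h : n < N) (m M : ℕ) :
    |pathWeight (n + 1) m N M - (n + 1) * harmonicFrom 0 N / ((n + 1) * harmonicFrom 0 N + M) *
        pathWeight n m N M| ≤
      ((m + (n + 1) * harmonicFrom 0 (n + 1)) / harmonicFrom 0 N + (n + 1) / √(harmonicFrom 0 N)) *
        pathWeight n m N M := by
  have hrec := pathWeight_eq_add h m M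
  have hup := sub_mul_pathWeight_le (Nat.succ_le_of_lt h) m M
  have hlo := le_mul_pathWeight (Nat.succ_le_of_lt h) m M
  have hH : 0 < harmonicFrom 0 N := by
    have h1 : harmonicFrom 0 1 = 1 := by simp [harmonicFrom]
    have := harmonicFrom_mono 0 (by omega : 1 ≤ N)
    linarith
  have hHn := harmonicFrom_nonneg 0 (n + 1)
  have hHM0 := harmonicFrom_nonneg 0 M
  have hHM := harmonicFrom_le_two_mul_sqrt M
  have hy0 := pathWeight_nonneg (n + 1) m N M
  have hx0 := pathWeight_nonneg (n + 1) (m + 1) N M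
  push_cast at hrec
  have hk : (1 : ℝ) ≤ n + 1 := by linarith [n.cast_nonneg (α := ℝ)]
  have hM : (0 : ℝ) ≤ M := M.cast_nonneg
  have hm : (0 : ℝ) ≤ m := m.cast_nonneg
  simp only [Nat.succ_eq_add_one] at *
  generalize harmonicFrom 0 (n + 1) = Hn at *
  generalize harmonicFrom 0 N = H at *
  generalize harmonicFrom 0 M = HM at *
  generalize pathWeight n m N M = p at *
  generalize pathWeight (n + 1) m N M = y at *
  generalize pathWeight (n + 1) (m + 1) N M = x at *
  generalize (n : ℝ) + 1 = k at *
  generalize (M : ℝ) = M at *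
  generalize (m : ℝ) = m at *
  have hk0 : 0 < k := by linarith
  have hD : 0 < k * H + M := by positivity
  have hxk : x = k * (p - y) := by rw [hrec]; field_simp; ring
  have hyp : y ≤ p := by rw [hrec]; linarith [div_nonneg hx0 hk0.le]
  have hp : 0 ≤ p := hy0.trans hyp
  have hxp : x ≤ k * p := by rw [hxk]; nlinarith
  have hHD : H ≤ k * H + M := by nlinarith
  have heq : y - k * H / (k * H + M) * p = (M * y - H * x) / (k * H + M) := by
    rw [hxk]; field_simp; ring
  have hroot : HM / (k * H + M) ≤ 1 / √H := by
    have hs : 0 < √H := Real.sqrt_pos.2 hH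
    have h1 := Real.sq_sqrt hH.le
    have h2 := Real.sq_sqrt hM
    rw [div_le_div_iff₀ hD hs, one_mul]
    nlinarith [sq_nonneg (√H - √M), mul_le_mul_of_nonneg_right hHM hs.le]
  rw [heq, abs_le]
  constructor
  · have h1 : H * x - M * y ≤ (Hn + HM) * (k * p) := by nlinarith
    have h2 : (H * x - M * y) / (k * H + M) ≤ (Hn + HM) * (k * p) / (k * H + M) := by gcongr
    have h3 : Hn / (k * H + M) ≤ Hn / H := by gcongr
    have h4 : (Hn + HM) * (k * p) / (k * H + M) =
      (Hn / (k * H + M) + HM / (k * H + M)) * (k * p) := by ring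
    have h5 : (Hn / (k * H + M) + HM / (k * H + M)) * (k * p) ≤
      (Hn / H + 1 / √H) * (k * p) := by gcongr
    have h6 : ((m + k * Hn) / H + k / √H) * p = (Hn / H + 1 / √H) * (k * p) + m / H * p := by ring
    have h7 : 0 ≤ m / H * p := by positivity
    have h8 : (M * y - H * x) / (k * H + M) = - ((H * x - M * y) / (k * H + M)) := by ring
    rw [h8]
    linarith
  · have h1 : M * y - H * x ≤ m * p := by nlinarith
    have h2 : (M * y - H * x) / (k * H + M) ≤ m * p / H := by gcongr
    have h3 : ((m + k * Hn) / H + k / √H) * p = m * p / H + (k * Hn / H + k / √H) * p := by ring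
    have h4 : 0 ≤ (k * Hn / H + k / √H) * p := by positivity
    linarith

theorem abs_sub_mul_mul_le {z p q r K e ε c C : ℝ} (h1 : |z - r * p| ≤ e * p)
    (h2 : |p - K * q| ≤ ε * q) (hr : 0 ≤ r) (hrc : r ≤ c) (hp : p ≤ C * q) (he : 0 ≤ e) :
    |z - K * r * q| ≤ (e * C + c * ε) * q := by
  have h3 : |r * (p - K * q)| ≤ c * (ε * q) := by
    rw [abs_mul, abs_of_nonneg hr]
    exact mul_le_mul hrc h2 (abs_nonneg _) (hr.trans hrc)
  calc |z - K * r * q| = |(z - r * p) + r * (p - K * q)| := by ring_nf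
    _ ≤ e * p + c * (ε * q) := (abs_add_le _ _).trans (add_le_add h1 h3)
    _ ≤ e * (C * q) + c * (ε * q) := by gcongr
    _ = (e * C + c * ε) * q := by ring

open Filter Topology in
theorem exists_abs_pathWeight_sub_mixKernel_le {n m : ℕ} (hm : m ≤ n) :
    ∃ (C : ℝ) (ε : ℕ → ℝ), Tendsto ε atTop (𝓝 0) ∧ ∀ N, n ≤ N → 1 ≤ N → ∀ M,
      pathWeight n m N M ≤ C * pathWeight 0 0 N M ∧
      |pathWeight n m N M - mixKernel n m (harmonicFrom 0 N / (harmonicFrom 0 N + M)) *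
        pathWeight 0 0 N M| ≤ ε N * pathWeight 0 0 N M := by
  induction n generalizing m with
  | zero =>
    obtain rfl : m = 0 := by omega
    exact ⟨1, 0, tendsto_const_nhds, fun N _ _ M => by simp [mixKernel]⟩
  | succ n ih =>
    have herr : ∀ m : ℕ, Tendsto (fun N => (m + (n + 1) * harmonicFrom 0 (n + 1)) /
        harmonicFrom 0 N + (n + 1) / √(harmonicFrom 0 N)) atTop (𝓝 0) := fun m => by
      simpa using (tendsto_harmonicFrom.const_div_atTop _).add
        ((Real.tendsto_sqrt_atTop.comp tendsto_harmonicFrom).const_div_atTop ((n : ℝ) + 1))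
    have hH : ∀ N, 1 ≤ N → 0 < harmonicFrom 0 N := fun N hN => by
      have h1 : harmonicFrom 0 1 = 1 := by simp [harmonicFrom]
      have := harmonicFrom_mono 0 hN
      linarith
    have he0 : ∀ (m N : ℕ), 0 ≤ (m + (n + 1) * harmonicFrom 0 (n + 1)) / harmonicFrom 0 N +
        (n + 1) / √(harmonicFrom 0 N) := fun m N => by
      have := harmonicFrom_nonneg 0 (n + 1)
      have := harmonicFrom_nonneg 0 N
      positivity
    rcases Nat.le_succ_iff.1 hm with hm | rfl
    · obtain ⟨C, ε, hε, hb⟩ := ih hm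
      refine ⟨C, fun N => ((m + (n + 1) * harmonicFrom 0 (n + 1)) / harmonicFrom 0 N +
        (n + 1) / √(harmonicFrom 0 N)) * C + 1 * ε N,
        by simpa using ((herr m).mul_const C).add hε, fun N hN hN1 M => ?_⟩
      obtain ⟨hC, hb⟩ := hb N (by omega) hN1 M
      have hle : pathWeight (n + 1) m N M ≤ pathWeight n m N M := by
        rw [pathWeight_eq_add hN]
        exact le_add_of_nonneg_right (div_nonneg (pathWeight_nonneg _ _ _ _) (by positivity))
      refine ⟨hle.trans hC, ?_⟩
      have hH := hH N hN1
      rw [mixKernel_succ_left hm, show ((n : ℝ) + 1) * (harmonicFrom 0 N / (harmonicFrom 0 N + M)) /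
        (1 + n * (harmonicFrom 0 N / (harmonicFrom 0 N + M))) =
        (n + 1) * harmonicFrom 0 N / ((n + 1) * harmonicFrom 0 N + M) by field_simp; ring]
      exact abs_sub_mul_mul_le (abs_pathWeight_succ_sub_le hN m M) hb (by positivity)
        (div_le_one_of_le₀ (by linarith [M.cast_nonneg (α := ℝ)]) (by positivity)) hC (he0 m N)
    · obtain ⟨C, ε, hε, hb⟩ := ih le_rfl
      have hlim := (((herr n).const_mul ((n : ℝ) + 1)).mul_const C).add
        (hε.const_mul ((n : ℝ) + 1))
      refine ⟨(n + 1) * C, fun N => ((n + 1) * ((n + (n + 1) * harmonicFrom 0 (n + 1)) /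
        harmonicFrom 0 N + (n + 1) / √(harmonicFrom 0 N))) * C + (n + 1) * ε N, by simpa using hlim,
        fun N hN hN1 M => ?_⟩
      obtain ⟨hC, hb⟩ := hb N (by omega) hN1 M
      have hx : pathWeight (n + 1) (n + 1) N M =
          (n + 1) * (pathWeight n n N M - pathWeight (n + 1) n N M) := by
        rw [pathWeight_eq_add hN n M]
        push_cast
        field_simp
        ring
      have hy := pathWeight_nonneg (n + 1) n N M
      have hn : (0 : ℝ) < n + 1 := by positivity
      refine ⟨by rw [hx, mul_assoc]; gcongr; linarith, ?_⟩
      have hH := hH N hN1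
      have hM : (0 : ℝ) ≤ M := M.cast_nonneg
      rw [mixKernel_succ_succ, show ((n : ℝ) + 1) *
        (1 - harmonicFrom 0 N / (harmonicFrom 0 N + M)) /
        (1 + n * (harmonicFrom 0 N / (harmonicFrom 0 N + M))) =
        (n + 1) * (M / ((n + 1) * harmonicFrom 0 N + M)) by field_simp; ring]
      refine abs_sub_mul_mul_le ?_ hb (by positivity) ?_ hC (mul_nonneg hn.le (he0 n N))
      · have hcompl : pathWeight (n + 1) (n + 1) N M -
            (n + 1) * (M / ((n + 1) * harmonicFrom 0 N + M)) * pathWeight n n N M =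
            -((n + 1) * (pathWeight (n + 1) n N M - (n + 1) * harmonicFrom 0 N /
              ((n + 1) * harmonicFrom 0 N + M) * pathWeight n n N M)) := by
          rw [hx]
          field_simp
          ring
        rw [hcompl, abs_neg, abs_mul, abs_of_pos hn, mul_assoc]
        exact mul_le_mul_of_nonneg_left (abs_pathWeight_succ_sub_le hN n M) hn.le
      · refine mul_le_of_le_one_right hn.le (div_le_one_of_le₀ ?_ (by positivity))
        linarith [mul_pos hn hH]

/-- Every nonnegative solution of the recursion is a mixture of the solutions `mixKernel`. -/
theorem exists_mixing_measure (u : ℕ → ℕ → ℝ) (hu0 : ∀ n m, 0 ≤ u n m) (h1 : u 0 0 = 1)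
    (hu : ∀ n m, m ≤ n → u n m = u (n + 1) m + u (n + 1) (m + 1) / ((n + 1 : ℕ) : ℝ)) :
    ∃ ν : Measure ℝ≥0∞, IsProbabilityMeasure ν ∧
      ∀ n m, m ≤ n → u n m = ∫ η, mixKernel n m (squash η) ∂ν := by
  have hsum : ∀ d n m, m ≤ n →
      u n m = ∑ M ∈ Finset.range (n + d + 1), pathWeight n m (n + d) M * u (n + d) M := by
    intro d
    induction d with
    | zero =>
      intro n m hm
      simp [pathWeight_self, Finset.sum_ite_eq', Nat.lt_succ_of_le hm]
    | succ d ih =>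
      intro n m hm
      rw [hu n m hm, ih (n + 1) m (by omega), ih (n + 1) (m + 1) (by omega), Finset.sum_div,
        ← Finset.sum_add_distrib, show n + 1 + d = n + (d + 1) by omega]
      refine Finset.sum_congr rfl fun M _ => ?_
      rw [pathWeight_eq_add (by omega : n < n + (d + 1))]
      ring
  let w : ℕ → ℕ → ℝ := fun N M => pathWeight 0 0 N M * u N M
  have hw0 : ∀ N M, 0 ≤ w N M := fun N M => mul_nonneg (pathWeight_nonneg _ _ _ _) (hu0 _ _)
  have hw1 : ∀ N, ∑ M ∈ Finset.range (N + 1), w N M = 1 := fun N => by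
    have := hsum N 0 0 le_rfl
    rw [zero_add, h1] at this
    exact this.symm
  let pt : ℕ → ℕ → ℝ≥0∞ := fun N M => ENNReal.ofReal (M / harmonicFrom 0 N)
  let ρ : ℕ → Measure ℝ≥0∞ := fun N =>
    ∑ M ∈ Finset.range (N + 1), ENNReal.ofReal (w N M) • Measure.dirac (pt N M)
  have hρ : ∀ N, IsProbabilityMeasure (ρ N) := fun N => ⟨by
    simp only [ρ, Measure.coe_finsetSum, Finset.sum_apply, Measure.smul_apply, measure_univ,
      smul_eq_mul, mul_one]
    rw [← ENNReal.ofReal_sum_of_nonneg fun M _ => hw0 N M, hw1, ENNReal.ofReal_one]⟩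
  have hint : ∀ N (f : ℝ≥0∞ → ℝ), ∫ η, f η ∂(ρ N) =
      ∑ M ∈ Finset.range (N + 1), w N M * f (pt N M) := fun N f => by
    simp only [ρ]
    rw [integral_finsetSum_measure]
    · refine Finset.sum_congr rfl fun M _ => ?_
      rw [integral_smul_measure, integral_dirac, ENNReal.toReal_ofReal (hw0 N M), smul_eq_mul]
    · exact fun M _ => (integrable_dirac (by simp)).smul_measure ENNReal.ofReal_ne_top
  let ρ' : ℕ → ProbabilityMeasure ℝ≥0∞ := fun N => ⟨ρ N, hρ N⟩
  obtain ⟨ν, hν⟩ : ∃ ν, Filter.map ρ' (Filter.hyperfilter ℕ) ≤ nhds ν := by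
    obtain ⟨ν, -, hν⟩ := isCompact_univ.ultrafilter_le_nhds ((Filter.hyperfilter ℕ).map ρ')
      (by simp)
    exact ⟨ν, hν⟩
  refine ⟨ν, inferInstance, fun n m hm => ?_⟩
  have hlim := (ProbabilityMeasure.tendsto_iff_forall_integral_tendsto.1 hν)
    (BoundedContinuousFunction.mkOfCompact ⟨_, continuous_mixKernel_squash n m⟩)
  have hlim2 : Filter.Tendsto (fun N => ∫ η, mixKernel n m (squash η) ∂(ρ N))
      (Filter.hyperfilter ℕ) (nhds (u n m)) := by
    obtain ⟨C, ε, hε, hb⟩ := exists_abs_pathWeight_sub_mixKernel_le hm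
    refine Filter.Tendsto.mono_left ?_ Nat.hyperfilter_le_atTop
    rw [tendsto_iff_dist_tendsto_zero]
    refine squeeze_zero' (Filter.Eventually.of_forall fun _ => dist_nonneg) ?_ hε
    filter_upwards [Filter.eventually_ge_atTop (n + 1)] with N hN
    have hH : 0 < harmonicFrom 0 N := by
      have h1 : harmonicFrom 0 1 = 1 := by simp [harmonicFrom]
      have := harmonicFrom_mono 0 (by omega : 1 ≤ N)
      linarith
    have hs := hsum (N - n) n m hm
    rw [show n + (N - n) = N by omega] at hs
    rw [dist_comm, Real.dist_eq, hint, hs, ← Finset.sum_sub_distrib, ← mul_one (ε N), ← hw1 N,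
      Finset.mul_sum]
    refine (Finset.abs_sum_le_sum_abs _ _).trans (Finset.sum_le_sum fun M _ => ?_)
    have hpt : (squash (pt N M) : ℝ) = harmonicFrom 0 N / (harmonicFrom 0 N + M) := by
      rw [squash_of_ne_top ENNReal.ofReal_ne_top, ENNReal.toReal_ofReal (by positivity)]
      field_simp
    have := mul_le_mul_of_nonneg_right (hb N (by omega) (by omega) M).2 (hu0 N M)
    rw [hpt]
    simp only [w]
    calc _ = |pathWeight n m N M - mixKernel n m (harmonicFrom 0 N / (harmonicFrom 0 N + M)) *
            pathWeight 0 0 N M| * u N M := by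
          rw [← abs_of_nonneg (hu0 N M), ← abs_mul, abs_of_nonneg (hu0 N M)]; ring_nf
      _ ≤ _ := by rw [← mul_assoc]; exact this
  exact tendsto_nhds_unique hlim2 hlim

theorem integrable_of_continuous_squash {f : ℝ≥0∞ → ℝ} (hf : Continuous f) (μ : Measure ℝ≥0∞)
    [IsProbabilityMeasure μ] : Integrable f μ :=
  hf.integrable_of_hasCompactSupport (HasCompactSupport.of_compactSpace f)

theorem prod_one_add_mul_squash_pos (n : ℕ) (η : ℝ≥0∞) :
    0 < ∏ j ∈ Finset.range n, (1 + j * (squash η : ℝ)) :=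
  Finset.prod_pos fun j _ => by
    have := (squash η).2.1
    positivity

/-- A probability measure on `[0,∞]` is determined by its integrals against `mixKernel`. -/
theorem measure_ext_of_integral_mixKernel {μ ν : Measure ℝ≥0∞} [IsProbabilityMeasure μ]
    [IsProbabilityMeasure ν]
    (h : ∀ n m, m ≤ n →
      ∫ η, mixKernel n m (squash η) ∂μ = ∫ η, mixKernel n m (squash η) ∂ν) : μ = ν := by
  have hsq : Continuous fun η => (squash η : ℝ) := continuous_subtype_val.comp continuous_squash
  have hcont : ∀ (n : ℕ) (g : ℝ → ℝ), Continuous g → Continuous fun η =>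
      g (squash η) / ∏ j ∈ Finset.range n, (1 + j * (squash η : ℝ)) := fun n g hg =>
    (hg.comp hsq).div (by fun_prop) fun η => (prod_one_add_mul_squash_pos n η).ne'
  have hint : ∀ (ρ : Measure ℝ≥0∞) [IsProbabilityMeasure ρ] (n : ℕ) (g : ℝ → ℝ), Continuous g →
      Integrable (fun η => g (squash η) / ∏ j ∈ Finset.range n, (1 + j * (squash η : ℝ))) ρ :=
    fun ρ _ n g hg => integrable_of_continuous_squash (hcont n g hg) ρ
  have hbern : ∀ n d a b : ℕ, a + b + d = n →
      ∫ η, ((squash η : ℝ) ^ a * (1 - squash η) ^ b) /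
          ∏ j ∈ Finset.range n, (1 + j * (squash η : ℝ)) ∂μ =
        ∫ η, ((squash η : ℝ) ^ a * (1 - squash η) ^ b) /
          ∏ j ∈ Finset.range n, (1 + j * (squash η : ℝ)) ∂ν := by
    intro n d
    induction d with
    | zero =>
      intro a b hab
      have hf : (n.factorial : ℝ) ≠ 0 := by positivity
      have hker : ∀ η, mixKernel n b (squash η) = n.factorial *
          (((squash η : ℝ) ^ a * (1 - squash η) ^ b) /
            ∏ j ∈ Finset.range n, (1 + j * (squash η : ℝ))) := by
        intro η
        rw [mixKernel, show n - b = a by omega]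
        ring
      have := h n b (by omega)
      simp only [hker, integral_const_mul] at this
      exact mul_left_cancel₀ hf this
    | succ d ih =>
      intro a b hab
      have key : ∀ (ρ : Measure ℝ≥0∞) [IsProbabilityMeasure ρ],
          ∫ η, ((squash η : ℝ) ^ a * (1 - squash η) ^ b) /
              ∏ j ∈ Finset.range n, (1 + j * (squash η : ℝ)) ∂ρ =
            ∫ η, ((squash η : ℝ) ^ (a + 1) * (1 - squash η) ^ b) /
              ∏ j ∈ Finset.range n, (1 + j * (squash η : ℝ)) ∂ρ +
            ∫ η, ((squash η : ℝ) ^ a * (1 - squash η) ^ (b + 1)) /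
              ∏ j ∈ Finset.range n, (1 + j * (squash η : ℝ)) ∂ρ := by
        intro ρ _
        rw [← integral_add (hint ρ n (fun y => y ^ (a + 1) * (1 - y) ^ b) (by fun_prop))
          (hint ρ n (fun y => y ^ a * (1 - y) ^ (b + 1)) (by fun_prop))]
        refine integral_congr_ae (Filter.Eventually.of_forall fun η => ?_)
        simp only
        ring
      rw [key μ, key ν, ih (a + 1) b (by omega), ih a (b + 1) (by omega)]
  have hpoly : ∀ (n : ℕ) (p : Polynomial ℝ), p.natDegree ≤ n →
      ∫ η, p.eval (squash η : ℝ) / ∏ j ∈ Finset.range n, (1 + j * (squash η : ℝ)) ∂μ =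
        ∫ η, p.eval (squash η : ℝ) / ∏ j ∈ Finset.range n, (1 + j * (squash η : ℝ)) ∂ν := by
    intro n p hp
    have key : ∀ (ρ : Measure ℝ≥0∞) [IsProbabilityMeasure ρ],
        ∫ η, p.eval (squash η : ℝ) / ∏ j ∈ Finset.range n, (1 + j * (squash η : ℝ)) ∂ρ =
          ∑ a ∈ Finset.range (n + 1), p.coeff a * ∫ η, ((squash η : ℝ) ^ a *
            (1 - squash η) ^ 0) / ∏ j ∈ Finset.range n, (1 + j * (squash η : ℝ)) ∂ρ := by
      intro ρ _
      simp_rw [← integral_const_mul]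
      rw [← integral_finsetSum _ fun a _ =>
        (hint ρ n (fun y => y ^ a * (1 - y) ^ 0) (by fun_prop)).const_mul (p.coeff a)]
      refine integral_congr_ae (Filter.Eventually.of_forall fun η => ?_)
      simp only
      rw [p.eval_eq_sum_range' (Nat.lt_succ_of_le hp), Finset.sum_div]
      exact Finset.sum_congr rfl fun a _ => by ring
    rw [key μ, key ν]
    refine Finset.sum_congr rfl fun a ha => ?_
    rw [hbern n (n - a) a 0 (by have := Finset.mem_range.1 ha; omega)]
  refine measure_ext_of_integral_squash fun k => ?_
  have hdeg : (∏ j ∈ Finset.range k, (1 + Polynomial.C (j : ℝ) * Polynomial.X)).natDegree ≤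
      k + 1 := by
    refine (Polynomial.natDegree_prod_le _ _).trans ((Finset.sum_le_card_nsmul _ _ 1
      fun j _ => ?_).trans (by simp))
    compute_degree
  have heval : ∀ η, (∏ j ∈ Finset.range k, (1 + Polynomial.C (j : ℝ) * Polynomial.X)).eval
      (squash η : ℝ) / ∏ j ∈ Finset.range (k + 1), (1 + j * (squash η : ℝ)) =
        1 / (1 + k * (squash η : ℝ)) := by
    intro η
    rw [Finset.prod_range_succ, Polynomial.eval_prod]
    simp only [Polynomial.eval_add, Polynomial.eval_one, Polynomial.eval_mul, Polynomial.eval_C,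
      Polynomial.eval_X]
    rw [← div_div, div_self (prod_one_add_mul_squash_pos k η).ne']
  simpa only [heval] using hpoly (k + 1) _ hdeg

/-- The number of records of a sequence of initial ranks, the first position excluded. -/
def recordCount {n : ℕ} (i : (j : Fin n) → Fin (j.val + 1)) : ℕ :=
  (Finset.univ.filter fun j : Fin n =>
    1 ≤ j.val ∧ ((i j).val = 0 ∨ (i j).val = j.val)).card

theorem recordCount_succ {n : ℕ} (i : (j : Fin (n + 1)) → Fin (j.val + 1)) :
    recordCount i = recordCount (fun j : Fin n => i j.castSucc) +
      if 1 ≤ n ∧ ((i (Fin.last n)).val = 0 ∨ (i (Fin.last n)).val = n) then 1 else 0 := by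
  simp only [recordCount, Finset.card_filter]
  rw [Fin.sum_univ_castSucc]
  rfl

/-- Extend a sequence of initial ranks by one more rank. -/
def rankSnoc {n : ℕ} (i : (j : Fin n) → Fin (j.val + 1)) (v : Fin (n + 1)) :
    (j : Fin (n + 1)) → Fin (j.val + 1) :=
  Fin.snoc (α := fun j : Fin (n + 1) => Fin (j.val + 1)) i v

theorem rankSnoc_castSucc {n : ℕ} (i : (j : Fin n) → Fin (j.val + 1)) (v : Fin (n + 1))
    (j : Fin n) : rankSnoc i v j.castSucc = i j :=
  Fin.snoc_castSucc (α := fun j : Fin (n + 1) => Fin (j.val + 1)) v i j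

theorem rankSnoc_last {n : ℕ} (i : (j : Fin n) → Fin (j.val + 1)) (v : Fin (n + 1)) :
    rankSnoc i v (Fin.last n) = v :=
  Fin.snoc_last (α := fun j : Fin (n + 1) => Fin (j.val + 1)) v i

theorem recordCount_rankSnoc {n : ℕ} (i : (j : Fin n) → Fin (j.val + 1)) (v : Fin (n + 1)) :
    recordCount (rankSnoc i v) = recordCount i +
      if 1 ≤ n ∧ (v.val = 0 ∨ v.val = n) then 1 else 0 := by
  rw [recordCount_succ, rankSnoc_last]
  simp only [rankSnoc_castSucc]

theorem measurableSet_rankCyl {n : ℕ} (i : (j : Fin n) → Fin (j.val + 1)) :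
    MeasurableSet (rankCyl i) := by
  have : rankCyl i = ⋂ j : Fin n, (fun ω : RankSpace => ω j.val) ⁻¹' {i j} := by
    ext ω
    simp [rankCyl]
  rw [this]
  exact MeasurableSet.iInter fun j => measurable_pi_apply _ (measurableSet_singleton _)

theorem mem_rankCyl_rankSnoc {n : ℕ} (i : (j : Fin n) → Fin (j.val + 1)) (v : Fin (n + 1))
    (ω : RankSpace) : ω ∈ rankCyl (rankSnoc i v) ↔ ω ∈ rankCyl i ∧ ω n = v := by
  change (∀ j : Fin (n + 1), _) ↔ (∀ j : Fin n, _) ∧ _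
  rw [Fin.forall_fin_succ']
  simp only [rankSnoc_castSucc, rankSnoc_last]
  rfl

theorem measure_rankCyl_eq_sum (P : Measure RankSpace) {n : ℕ}
    (i : (j : Fin n) → Fin (j.val + 1)) :
    P (rankCyl i) = ∑ v : Fin (n + 1), P (rankCyl (rankSnoc i v)) := by
  have h : rankCyl i = ⋃ v : Fin (n + 1), rankCyl (rankSnoc i v) := by
    ext ω
    simp [mem_rankCyl_rankSnoc]
  rw [h, measure_iUnion _ fun v => measurableSet_rankCyl _, tsum_fintype]
  intro v w hvw
  refine Set.disjoint_left.2 fun ω hv hw => hvw ?_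
  rw [mem_rankCyl_rankSnoc] at hv hw
  exact hv.2.symm.trans hw.2

theorem exists_recordCount_eq {n m : ℕ} (hm : m ≤ n) :
    ∃ i : (j : Fin (n + 2)) → Fin (j.val + 1), recordCount i = m + 1 := by
  induction n generalizing m with
  | zero =>
    obtain rfl : m = 0 := by omega
    exact ⟨fun _ => 0, by rw [recordCount_succ, recordCount_succ]; simp [recordCount]⟩
  | succ n ih =>
    rcases Nat.le_succ_iff.1 hm with hm | rfl
    · obtain ⟨i, hi⟩ := ih hm
      refine ⟨rankSnoc i ⟨1, by omega⟩, ?_⟩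
      rw [recordCount_rankSnoc, hi, if_neg (by simp)]
    · obtain ⟨i, hi⟩ := ih le_rfl
      refine ⟨rankSnoc i 0, ?_⟩
      rw [recordCount_rankSnoc, hi, if_pos (by simp)]

theorem symWt_eq_ofReal (η : ℝ≥0∞) (n : ℕ) (v : Fin (n + 2 + 1)) :
    symWt η (n + 2) v = ENNReal.ofReal (if v.val = 0 ∨ v.val = n + 2
      then (1 - squash η) / 2 / (1 + n * squash η) else squash η / (1 + n * squash η)) := by
  rw [symWt, if_neg (by omega), if_neg (by omega), show n + 2 - 1 = n + 1 by omega]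
  rcases eq_or_ne η 0 with rfl | h0
  · rw [if_pos rfl, squash_zero]
    split_ifs
    · simp
    · rw [ENNReal.ofReal_div_of_pos (by positivity), mul_one, add_comm (1 : ℝ),
        ENNReal.ofReal_add (by positivity) zero_le_one]
      simp
  rw [if_neg h0]
  rcases eq_or_ne η ⊤ with rfl | ht
  · rw [if_pos rfl, squash_top]
    split_ifs
    · simp [ENNReal.ofReal_inv_of_pos]
    · simp
  rw [if_neg ht, squash_of_ne_top ht]
  lift η to NNReal using ht
  have hpos : (0 : ℝ) ≤ η := η.2
  have hden : (η : ℝ≥0∞) + ((n + 1 : ℕ) : ℝ≥0∞) = ENNReal.ofReal (η + (n + 1)) := by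
    rw [ENNReal.ofReal_add hpos (by positivity), ENNReal.ofReal_add (by positivity) zero_le_one]
    simp
  rw [hden, ENNReal.coe_toReal]
  split_ifs
  · rw [show (1 - 1 / (1 + (η : ℝ))) / 2 / (1 + n * (1 / (1 + η))) = η / 2 / (η + (n + 1)) by
      field_simp; ring, ENNReal.ofReal_div_of_pos (by positivity),
      ENNReal.ofReal_div_of_pos (by positivity)]
    simp
  · rw [show 1 / (1 + (η : ℝ)) / (1 + n * (1 / (1 + η))) = 1 / (η + (n + 1)) by
      field_simp; ring, ENNReal.ofReal_div_of_pos (by positivity)]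
    simp

theorem exists_prod_symWt_eq {n : ℕ} (i : (j : Fin (n + 2)) → Fin (j.val + 1)) :
    ∃ m ≤ n, recordCount i = m + 1 ∧ ∀ η, ∏ j : Fin (n + 2), symWt η j.val (i j) =
      ENNReal.ofReal (mixKernel n m (squash η) / (2 * 2 ^ m * n.factorial)) := by
  induction n with
  | zero =>
    refine ⟨0, le_rfl, ?_, fun η => ?_⟩
    · have := (i (Fin.last 1)).2
      rw [recordCount_succ, recordCount_succ, if_neg (by simp), if_pos ⟨by simp, by omega⟩]
      simp [recordCount]
    · simp [Fin.prod_univ_two, symWt, mixKernel, ENNReal.ofReal_inv_of_pos]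
  | succ n ih =>
    obtain ⟨m, hm, hrec, hprod⟩ := ih fun j => i j.castSucc
    have hy0 : ∀ η, 0 ≤ mixKernel n m (squash η) / (2 * 2 ^ m * n.factorial) := fun η =>
      div_nonneg (mixKernel_squash_nonneg n m η) (by positivity)
    have hstep : ∀ η, ∏ j : Fin (n + 1 + 2), symWt η j.val (i j) =
        ENNReal.ofReal (mixKernel n m (squash η) / (2 * 2 ^ m * n.factorial) *
          if (i (Fin.last (n + 2))).val = 0 ∨ (i (Fin.last (n + 2))).val = n + 2
          then (1 - (squash η : ℝ)) / 2 / (1 + n * squash η)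
          else (squash η : ℝ) / (1 + n * squash η)) := by
      intro η
      rw [Fin.prod_univ_castSucc, ENNReal.ofReal_mul (hy0 η), ← hprod η, ← symWt_eq_ofReal]
      rfl
    rw [recordCount_succ, hrec]
    by_cases hl : (i (Fin.last (n + 2))).val = 0 ∨ (i (Fin.last (n + 2))).val = n + 2
    · refine ⟨m + 1, by omega, by rw [if_pos ⟨by omega, hl⟩], fun η => ?_⟩
      rw [hstep, if_pos hl, mixKernel_succ_succ, Nat.factorial_succ]
      congr 1
      push_cast
      field_simp
      ring
    · refine ⟨m, by omega, by rw [if_neg fun h => hl h.2], fun η => ?_⟩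
      rw [hstep, if_neg hl, mixKernel_succ_left hm, Nat.factorial_succ]
      congr 1
      push_cast
      field_simp

theorem rankCyl_eq_univ_of_le_one {n : ℕ} (hn : n ≤ 1) (i : (j : Fin n) → Fin (j.val + 1)) :
    rankCyl i = Set.univ := by
  refine Set.eq_univ_of_forall fun ω j => Fin.ext ?_
  have := (ω j.val).2
  have := (i j).2
  omega

theorem prod_symWt_of_le_one {n : ℕ} (hn : n ≤ 1) (i : (j : Fin n) → Fin (j.val + 1))
    (η : ℝ≥0∞) : ∏ j : Fin n, symWt η j.val (i j) = 1 :=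
  Finset.prod_eq_one fun j _ => by rw [symWt, if_pos (by omega)]

open Classical in
/-- The common probability of the cylinders of length `n + 2` with `m + 1` records. -/
noncomputable def cylProb (P : Measure RankSpace) (n m : ℕ) : ℝ :=
  if h : ∃ i : (j : Fin (n + 2)) → Fin (j.val + 1), recordCount i = m + 1 then
    (P (rankCyl h.choose)).toReal else 0

theorem cylProb_nonneg (P : Measure RankSpace) (n m : ℕ) : 0 ≤ cylProb P n m := by
  unfold cylProb
  split_ifs
  exacts [ENNReal.toReal_nonneg, le_rfl]

theorem toReal_measure_rankCyl {P : Measure RankSpace}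
    (hP : ∀ (n : ℕ) (i i' : (j : Fin n) → Fin (j.val + 1)),
      recordCount i = recordCount i' → P (rankCyl i) = P (rankCyl i'))
    {n m : ℕ} {i : (j : Fin (n + 2)) → Fin (j.val + 1)}
    (hi : recordCount i = m + 1) : (P (rankCyl i)).toReal = cylProb P n m := by
  have h : ∃ i : (j : Fin (n + 2)) → Fin (j.val + 1), recordCount i = m + 1 := ⟨i, hi⟩
  rw [cylProb, dif_pos h, hP _ i h.choose (hi.trans h.choose_spec.symm)]

theorem cylProb_zero_zero {P : Measure RankSpace} [IsProbabilityMeasure P]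
    (hP : ∀ (n : ℕ) (i i' : (j : Fin n) → Fin (j.val + 1)),
      recordCount i = recordCount i' → P (rankCyl i) = P (rankCyl i')) :
    cylProb P 0 0 = 1 / 2 := by
  have h := measure_rankCyl_eq_sum P (n := 1) fun _ => 0
  rw [rankCyl_eq_univ_of_le_one le_rfl, measure_univ] at h
  have h' := congrArg ENNReal.toReal h
  rw [ENNReal.toReal_sum fun _ _ => measure_ne_top _ _, Fin.sum_univ_two,
    toReal_measure_rankCyl hP (m := 0), toReal_measure_rankCyl hP (m := 0)] at h'
  · simp at h'
    linarith
  · rw [recordCount_rankSnoc, recordCount_succ]; simp [recordCount]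
  · rw [recordCount_rankSnoc, recordCount_succ]; simp [recordCount]

theorem cylProb_eq_add {P : Measure RankSpace} [IsProbabilityMeasure P]
    (hP : ∀ (n : ℕ) (i i' : (j : Fin n) → Fin (j.val + 1)),
      recordCount i = recordCount i' → P (rankCyl i) = P (rankCyl i'))
    {n m : ℕ} (hm : m ≤ n) :
    cylProb P n m = (n + 1) * cylProb P (n + 1) m + 2 * cylProb P (n + 1) (m + 1) := by
  obtain ⟨i, hi⟩ := exists_recordCount_eq hm
  rw [← toReal_measure_rankCyl hP hi, measure_rankCyl_eq_sum,
    ENNReal.toReal_sum fun _ _ => measure_ne_top _ _, Fin.sum_univ_succ, Fin.sum_univ_castSucc]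
  rw [toReal_measure_rankCyl hP (m := m + 1) (by rw [recordCount_rankSnoc, hi, if_pos (by simp)]),
    toReal_measure_rankCyl hP (m := m + 1) (by rw [recordCount_rankSnoc, hi, if_pos (by simp)]),
    Finset.sum_congr rfl fun k _ => toReal_measure_rankCyl hP (m := m) (by
      rw [recordCount_rankSnoc, hi, if_neg]
      have := k.2
      simp
      omega)]
  simp
  ring

/-- if each cylinder probability depends only on the total number of
records `#{2 ≤ j ≤ n : i_j ∈ {1, j}}`, then `P` is a unique mixture of the laws `R^η`,
`η ∈ [0,∞]`. -/
theorem stmt_14 (P : Measure RankSpace) [IsProbabilityMeasure P]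
    (hP : ∀ (n : ℕ) (i i' : (j : Fin n) → Fin (j.val + 1)),
      (Finset.univ.filter fun j : Fin n =>
          1 ≤ j.val ∧ ((i j).val = 0 ∨ (i j).val = j.val)).card
        = (Finset.univ.filter fun j : Fin n =>
          1 ≤ j.val ∧ ((i' j).val = 0 ∨ (i' j).val = j.val)).card →
      P (rankCyl i) = P (rankCyl i')) :
    ∃! ν : Measure ℝ≥0∞, IsProbabilityMeasure ν ∧
      ∀ (n : ℕ) (i : (j : Fin n) → Fin (j.val + 1)),
        P (rankCyl i) = ∫⁻ η, ∏ j : Fin n, symWt η j.val (i j) ∂ν := by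
  have hlint : ∀ (ν : Measure ℝ≥0∞) [IsProbabilityMeasure ν] (n m : ℕ),
      ∫⁻ η, ENNReal.ofReal (mixKernel n m (squash η) / (2 * 2 ^ m * n.factorial)) ∂ν =
        ENNReal.ofReal ((∫ η, mixKernel n m (squash η) ∂ν) / (2 * 2 ^ m * n.factorial)) := by
    intro ν _ n m
    rw [← integral_div, ofReal_integral_eq_lintegral_ofReal]
    · exact integrable_of_continuous_squash ((continuous_mixKernel_squash n m).div_const _) ν
    · exact Filter.Eventually.of_forall fun η =>
        div_nonneg (mixKernel_squash_nonneg n m η) (by positivity)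
  obtain ⟨ν, hν, hmix⟩ := exists_mixing_measure
    (fun n m => 2 * 2 ^ m * n.factorial * cylProb P n m)
    (fun n m => mul_nonneg (by positivity) (cylProb_nonneg P n m))
    (by simp [cylProb_zero_zero hP])
    (fun n m hm => by
      rw [cylProb_eq_add hP hm, Nat.factorial_succ]
      push_cast
      field_simp
      ring)
  refine ⟨ν, ⟨hν, fun n i => ?_⟩, fun ν' ⟨hν', h'⟩ => measure_ext_of_integral_mixKernel ?_⟩
  · rcases le_or_gt n 1 with hn | hn
    · simp [rankCyl_eq_univ_of_le_one hn, prod_symWt_of_le_one hn]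
    · obtain ⟨n, rfl⟩ := Nat.exists_eq_add_of_le' hn
      obtain ⟨m, hm, hrec, hprod⟩ := exists_prod_symWt_eq i
      rw [lintegral_congr hprod, hlint, ← hmix n m hm, mul_div_cancel_left₀ _ (by positivity),
        ← toReal_measure_rankCyl hP hrec, ENNReal.ofReal_toReal (measure_ne_top _ _)]
  · intro n m hm
    obtain ⟨i, hi⟩ := exists_recordCount_eq hm
    obtain ⟨m', hm', hrec, hprod⟩ := exists_prod_symWt_eq i
    obtain rfl : m' = m := by omega
    have h := congrArg ENNReal.toReal (h' (n + 2) i)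
    rw [lintegral_congr hprod, hlint, toReal_measure_rankCyl hP hrec,
      ENNReal.toReal_ofReal (div_nonneg (integral_nonneg fun η => mixKernel_squash_nonneg _ _ _)
        (by positivity)), _root_.eq_div_iff (by positivity), mul_comm] at h
    rw [← h, ← hmix n m' hm]
end

section
/- Let P be a probability measure on Ω = ∏_{n≥1} {1,…,n} such that for every n the cylinder probability P(ω_1 = i_1, …, ω_n = i_n) depends on (i_1,…,i_n) only through the pair (#{2 ≤ j ≤ n : i_j = 1}, #{2 ≤ j ≤ n : i_j = j}) (equivalently, each random permutation π_n is conditionally uniform given its numbers of lower and upper records). For (η,p) ∈ [0,∞] × [0,1] let M^{(η,p)} be the probability measure on Ω under which the coordinates are independent, ω_1 = 1, ω_2 = 1 with probability p and ω_2 = 2 with probability 1−p, and for n ≥ 3: if η ∈ (0,∞) then M^{(η,p)}(ω_n = 1) = pη/(η+n−2), M^{(η,p)}(ω_n = n) = (1−p)η/(η+n−2), and M^{(η,p)}(ω_n = r) = 1/(η+n−2) for 2 ≤ r ≤ n−1; if η = 0 then ω_n is uniform on {2,…,n−1}; if η = ∞ then ω_n = 1 with probability p and ω_n = n with probability 1−p.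 Let E = ([0,∞] × [0,1]) ∖ ({0} × (0,1)). Then there exists a unique probability measure ν on E such that P(A) = ∫_E M^{(η,p)}(A) dν(η,p) for every cylinder event A. -/
open MeasureTheory ENNReal

/-- the `M^{(η,p)}`-probability that the coordinate of index `j` equals `v`
(`j = 1` encodes `ω_2`, equal to rank `1` w.p. `p` and rank `2` w.p. `1−p`; for `j ≥ 2`,
encoding `ω_n` with `n = j+1 ≥ 3`: if `η ∈ (0,∞)` then rank `1` has probability
`pη/(η+n−2)`, rank `n` has probability `(1−p)η/(η+n−2)` and each middle rank
`1/(η+n−2)`; if `η = 0` then uniform on middle ranks; if `η = ∞` then rank `1` w.p.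
`p` and rank `n` w.p. `1−p`). -/
noncomputable def twoParWt (η : ℝ≥0∞) (p : ℝ) (j : ℕ) (v : Fin (j + 1)) : ℝ≥0∞ :=
  if j = 0 then 1
  else if j = 1 then (if v.val = 0 then ENNReal.ofReal p else ENNReal.ofReal (1 - p))
  else if η = 0 then
    (if v.val = 0 ∨ v.val = j then 0 else 1 / ((j - 1 : ℕ) : ℝ≥0∞))
  else if η = ⊤ then
    (if v.val = 0 then ENNReal.ofReal p
     else if v.val = j then ENNReal.ofReal (1 - p) else 0)
  else
    (if v.val = 0 then ENNReal.ofReal p * η / (η + ((j - 1 : ℕ) : ℝ≥0∞))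
     else if v.val = j then ENNReal.ofReal (1 - p) * η / (η + ((j - 1 : ℕ) : ℝ≥0∞))
     else 1 / (η + ((j - 1 : ℕ) : ℝ≥0∞)))

/-- the parameter set `E = ([0,∞] × [0,1]) ∖ ({0} × (0,1))` -/
def extremeParams : Set (ℝ≥0∞ × ℝ) :=
  (Set.univ ×ˢ Set.Icc (0 : ℝ) 1) \ ({0} ×ˢ Set.Ioo (0 : ℝ) 1)

section Hausdorff
open Filter Topology NNReal

variable {ι : Type*} [Fintype ι]

/-- The monomial on the standard simplex given by a word. -/
noncomputable def wordMonomial (w : List ι) (x : stdSimplex ℝ≥0 ι) : ℝ≥0 := (w.map x).prod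

@[simp] lemma wordMonomial_nil (x : stdSimplex ℝ≥0 ι) : wordMonomial [] x = 1 := by
  simp [wordMonomial]

@[simp] lemma wordMonomial_cons (i : ι) (w : List ι) (x : stdSimplex ℝ≥0 ι) :
    wordMonomial (i :: w) x = x i * wordMonomial w x := by
  simp [wordMonomial]

lemma continuous_stdSimplex_apply (i : ι) : Continuous fun x : stdSimplex ℝ≥0 ι => x i :=
  (continuous_apply i).comp continuous_subtype_val

lemma continuous_wordMonomial (w : List ι) :
    Continuous (wordMonomial w : stdSimplex ℝ≥0 ι → ℝ≥0) := by
  induction w with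
  | nil => exact continuous_const
  | cons i w ih => exact ((continuous_stdSimplex_apply i).mul ih).congr fun x => by simp

lemma wordMonomial_le_one (w : List ι) (x : stdSimplex ℝ≥0 ι) : wordMonomial w x ≤ 1 := by
  induction w with
  | nil => simp
  | cons i w ih => simpa using mul_le_one' (stdSimplex.le_one x i) ih

lemma wordMonomial_le_add (w : List ι) (x y : stdSimplex ℝ≥0 ι) (δ : ℝ≥0)
    (h : ∀ i, x i ≤ y i + δ) : wordMonomial w x ≤ wordMonomial w y + w.length * δ := by
  induction w with
  | nil => simp
  | cons i w ih =>
    simp only [wordMonomial_cons, List.length_cons, Nat.cast_add, Nat.cast_one]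
    calc x i * wordMonomial w x ≤ (y i + δ) * wordMonomial w x := by gcongr; exact h i
      _ = y i * wordMonomial w x + δ * wordMonomial w x := by ring
      _ ≤ y i * (wordMonomial w y + w.length * δ) + δ * 1 := by
          gcongr; exact wordMonomial_le_one w x
      _ = y i * wordMonomial w y + y i * (w.length * δ) + δ := by ring
      _ ≤ y i * wordMonomial w y + 1 * (w.length * δ) + δ := by
          gcongr; exact stdSimplex.le_one y i
      _ = _ := by ring

variable [DecidableEq ι] {H : Type*} (X : ι → H → H) (val : H → ℝ≥0)

/-- The law of the letter counts of a word of length `N`, when words have weight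
`val (X_w h)`. -/
noncomputable def countMeasure : ℕ → H → Measure (ι → ℕ)
  | 0, h => (val h : ℝ≥0∞) • Measure.dirac 0
  | N + 1, h => ∑ i, (countMeasure N (X i h)).map (· + Pi.single i 1)

lemma lintegral_countMeasure_succ (N : ℕ) (h : H) (F : (ι → ℕ) → ℝ≥0∞) :
    ∫⁻ c, F c ∂countMeasure X val (N + 1) h
      = ∑ i, ∫⁻ c, F (c + Pi.single i 1) ∂countMeasure X val N (X i h) := by
  rw [countMeasure, lintegral_finsetSum_measure]
  refine Finset.sum_congr rfl fun i _ => ?_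
  rw [lintegral_map (Measurable.of_discrete) (Measurable.of_discrete)]

lemma lintegral_countMeasure_mul (hX : ∀ i j h, X i (X j h) = X j (X i h)) (i : ι) (N : ℕ) (h : H)
    (F : (ι → ℕ) → ℝ≥0∞) :
    ∫⁻ c, (c i : ℝ≥0∞) * F c ∂countMeasure X val (N + 1) h
      = (N + 1 : ℕ) * ∫⁻ c, F (c + Pi.single i 1) ∂countMeasure X val N (X i h) := by
  have step : ∀ N h (F : (ι → ℕ) → ℝ≥0∞),
      ∫⁻ c, (c i : ℝ≥0∞) * F c ∂countMeasure X val (N + 1) h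
        = ∑ j, ∫⁻ c, (c i : ℝ≥0∞) * F (c + Pi.single j 1) ∂countMeasure X val N (X j h)
          + ∫⁻ c, F (c + Pi.single i 1) ∂countMeasure X val N (X i h) := by
    intro N h F
    rw [lintegral_countMeasure_succ]
    have : ∀ j, ∫⁻ c, (((c + Pi.single j 1 : ι → ℕ) i : ℕ) : ℝ≥0∞) * F (c + Pi.single j 1)
          ∂countMeasure X val N (X j h)
        = ∫⁻ c, (c i : ℝ≥0∞) * F (c + Pi.single j 1) ∂countMeasure X val N (X j h)
          + (if j = i then ∫⁻ c, F (c + Pi.single i 1) ∂countMeasure X val N (X i h) else 0) := by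
      intro j
      split_ifs with hji
      · subst hji
        rw [← lintegral_add_left Measurable.of_discrete]
        simp [add_mul]
      · simp [Pi.single_eq_of_ne (Ne.symm hji)]
    rw [Finset.sum_congr rfl fun j _ => this j, Finset.sum_add_distrib]
    simp
  induction N generalizing h F with
  | zero =>
    rw [step]
    simp [countMeasure, lintegral_smul_measure]
  | succ N ih =>
    rw [step]
    simp only [ih]
    rw [← Finset.mul_sum]
    have : ∑ j, ∫⁻ c, F (c + Pi.single i 1 + Pi.single j 1) ∂countMeasure X val N (X i (X j h))
        = ∫⁻ c, F (c + Pi.single i 1) ∂countMeasure X val (N + 1) (X i h) := by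
      rw [lintegral_countMeasure_succ]
      simp only [hX i, add_right_comm]
    rw [this]
    push_cast
    ring

lemma countMeasure_univ (hval : ∀ h, val h = ∑ i, val (X i h)) (N : ℕ) (h : H) :
    countMeasure X val N h Set.univ = val h := by
  induction N generalizing h with
  | zero => simp [countMeasure]
  | succ N ih =>
    have := lintegral_countMeasure_succ X val N h (fun _ => 1)
    simp only [lintegral_one, ih] at this
    rw [this, hval h]
    push_cast
    rfl

lemma ae_countMeasure_sum_eq (N : ℕ) (h : H) : ∀ᵐ c ∂countMeasure X val N h, ∑ i, c i = N := by
  induction N generalizing h with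
  | zero =>
    rw [countMeasure]
    exact Measure.ae_smul_measure (by rw [ae_dirac_eq]; simp) _
  | succ N ih =>
    rw [countMeasure, ae_iff, Measure.finsetSum_apply]
    refine Finset.sum_eq_zero fun i _ => ?_
    rw [← ae_iff, ae_map_iff Measurable.of_discrete.aemeasurable (MeasurableSet.of_discrete)]
    filter_upwards [ih (X i h)] with c hc
    simp [Finset.sum_add_distrib, hc]

variable [Nonempty ι]

open Classical in
/-- The empirical frequencies of a count vector. -/
noncomputable def freq (N : ℕ) (c : ι → ℕ) : stdSimplex ℝ≥0 ι :=
  if h : ∑ i, c i = N ∧ N ≠ 0 then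
    ⟨fun i => c i / N, fun i => zero_le, by
      rw [← Finset.sum_div, ← Nat.cast_sum, h.1, div_self (by exact_mod_cast h.2)]⟩
  else stdSimplex.vertex (Classical.arbitrary ι)

lemma freq_apply {N : ℕ} {c : ι → ℕ} (h : ∑ i, c i = N) (hN : N ≠ 0) (i : ι) :
    freq N c i = c i / N := by
  rw [freq, dif_pos ⟨h, hN⟩]; rfl

lemma tendsto_of_le_add {a b ε : ℕ → ℝ≥0∞} {L : ℝ≥0∞} (hL : L ≠ ∞) (ha : Tendsto a atTop (𝓝 L))
    (hε : Tendsto ε atTop (𝓝 0)) (h1 : ∀ᶠ n in atTop, b n ≤ a n + ε n)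
    (h2 : ∀ᶠ n in atTop, a n ≤ b n + ε n) : Tendsto b atTop (𝓝 L) := by
  have l1 : Tendsto (fun n => a n + ε n) atTop (𝓝 L) := by simpa using ha.add hε
  have l2 : Tendsto (fun n => a n - ε n) atTop (𝓝 L) := by
    simpa using ENNReal.Tendsto.sub ha hε (Or.inl hL)
  exact tendsto_of_tendsto_of_tendsto_of_le_of_le' l2 l1
    (h2.mono fun n hn => tsub_le_iff_right.2 hn) h1

lemma tendsto_lintegral_wordMonomial_freq (hX : ∀ i j h, X i (X j h) = X j (X i h))
    (hval : ∀ h, val h = ∑ i, val (X i h)) (w : List ι) (h : H) :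
    Tendsto (fun N => ∫⁻ c, wordMonomial w (freq N c) ∂countMeasure X val N h) atTop
      (𝓝 (val (w.foldl (fun h i => X i h) h))) := by
  induction w generalizing h with
  | nil => simp [countMeasure_univ X val hval]
  | cons i w ih =>
    rw [← tendsto_add_atTop_iff_nat 1]
    have e : ∀ N, ∫⁻ c, wordMonomial (i :: w) (freq (N + 1) c) ∂countMeasure X val (N + 1) h
        = ∫⁻ c, wordMonomial w (freq (N + 1) (c + Pi.single i 1))
            ∂countMeasure X val N (X i h) := by
      intro N
      have hN : ((N + 1 : ℕ) : ℝ≥0∞) ≠ 0 := by simp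
      have := lintegral_countMeasure_mul X val hX i N h
        (fun c => ((N + 1 : ℕ) : ℝ≥0∞)⁻¹ * wordMonomial w (freq (N + 1) c))
      rw [lintegral_const_mul _ Measurable.of_discrete, ← mul_assoc,
        ENNReal.mul_inv_cancel hN (natCast_ne_top _), one_mul] at this
      rw [← this]
      refine lintegral_congr_ae ?_
      filter_upwards [ae_countMeasure_sum_eq X val (N + 1) h] with c hc
      rw [wordMonomial_cons, freq_apply hc (Nat.succ_ne_zero N), ENNReal.coe_mul,
        ENNReal.coe_div (by positivity), div_eq_mul_inv]
      push_cast
      ring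
    simp only [e, List.foldl_cons]
    have bound : ∀ N, N ≠ 0 → ∀ᵐ c ∂countMeasure X val N (X i h),
        (wordMonomial w (freq (N + 1) (c + Pi.single i 1))
            ≤ wordMonomial w (freq N c) + w.length * (1 / (N + 1 : ℝ≥0))) ∧
        (wordMonomial w (freq N c) ≤ wordMonomial w (freq (N + 1) (c + Pi.single i 1))
          + w.length * (1 / (N + 1 : ℝ≥0))) := by
      intro N hN
      filter_upwards [ae_countMeasure_sum_eq X val N (X i h)] with c hc
      have hc' : ∑ j, (c + Pi.single i 1 : ι → ℕ) j = N + 1 := by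
        simp [Finset.sum_add_distrib, hc]
      have hN' : (0 : ℝ) < N := by positivity
      have key : ∀ j, (0 : ℝ) ≤ c j ∧ (c j : ℝ) ≤ N ∧ (0:ℝ) ≤ (Pi.single i 1 : ι → ℕ) j ∧
          (((Pi.single i 1 : ι → ℕ) j : ℕ) : ℝ) ≤ 1 := by
        intro j
        refine ⟨by positivity, ?_, by positivity, ?_⟩
        · rw [← hc]; exact_mod_cast Finset.single_le_sum (fun _ _ => Nat.zero_le _)
            (Finset.mem_univ j)
        · by_cases hj : j = i
          · subst hj; simp
          · simp [Pi.single_eq_of_ne hj]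
      refine ⟨wordMonomial_le_add _ _ _ _ fun j => ?_, wordMonomial_le_add _ _ _ _ fun j => ?_⟩
      all_goals
        rw [freq_apply hc hN, freq_apply hc' (Nat.succ_ne_zero N), ← NNReal.coe_le_coe]
        obtain ⟨k0, k1, k2, k3⟩ := key j
        push_cast [Pi.add_apply]
        generalize (c j : ℝ) = y at *
        generalize (((Pi.single i 1 : ι → ℕ) j : ℕ) : ℝ) = z at *
        have hN1 : (0 : ℝ) < N + 1 := by positivity
        have hyN : y / N * (N + 1) = y + y / N := by field_simp
        have hy1 : y / N ≤ 1 := (div_le_one hN').2 k1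
      · rw [div_le_iff₀ hN1, add_mul, hyN, one_div, inv_mul_cancel₀ hN1.ne']
        have : 0 ≤ y / N := div_nonneg k0 hN'.le
        linarith
      · rw [← add_div, le_div_iff₀ hN1, hyN]
        linarith
    refine tendsto_of_le_add (ε := fun N => (w.length * (1 / (N + 1 : ℝ≥0)) : ℝ≥0) * val (X i h))
      ENNReal.coe_ne_top (ih (X i h)) ?_ ?_ ?_
    · have : Tendsto (fun N : ℕ => (w.length : ℝ≥0) * (1 / (N + 1 : ℝ≥0)) * val (X i h)) atTop
          (𝓝 (w.length * 0 * val (X i h))) :=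
        (tendsto_one_div_add_atTop_nhds_zero_nat.const_mul _).mul_const _
      simp only [mul_zero, zero_mul] at this
      have h0 := (ENNReal.tendsto_coe.2 this)
      simpa using h0
    all_goals
      filter_upwards [eventually_ne_atTop 0] with N hN
      rw [← countMeasure_univ X val hval N (X i h), ← lintegral_const,
        ← lintegral_add_left Measurable.of_discrete]
      refine lintegral_mono_ae ?_
      filter_upwards [bound N hN] with c hc
    · exact_mod_cast hc.1
    · exact_mod_cast hc.2

/-- **Hausdorff moment problem on the simplex**, in operator form. -/
theorem exists_measure_lintegral_wordMonomial (hX : ∀ i j h, X i (X j h) = X j (X i h))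
    (hval : ∀ h, val h = ∑ i, val (X i h)) (h : H) :
    ∃ ρ : Measure (stdSimplex ℝ≥0 ι), IsFiniteMeasure ρ ∧
      ∀ w : List ι, ∫⁻ x, wordMonomial w x ∂ρ = val (w.foldl (fun h i => X i h) h) := by
  have hm : ∀ N, Measurable (freq (ι := ι) N) := fun N => Measurable.of_discrete
  have hu : ∀ N, ((countMeasure X val N h).map (freq N)) Set.univ = val h := fun N => by
    rw [Measure.map_apply (hm N) MeasurableSet.univ, Set.preimage_univ,
      countMeasure_univ X val hval]
  let ρ : ℕ → FiniteMeasure (stdSimplex ℝ≥0 ι) := fun N =>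
    ⟨(countMeasure X val N h).map (freq N), ⟨by rw [hu]; exact ENNReal.coe_lt_top⟩⟩
  have hc := isCompact_setOfPred_finiteMeasure_eq_of_compactSpace (E := stdSimplex ℝ≥0 ι) (val h)
  obtain ⟨σ, -, hσ⟩ := hc.ultrafilter_le_nhds' ((hyperfilter ℕ).map ρ) (by
    refine Filter.mem_map.2 (Filter.Eventually.of_forall fun N => ?_)
    have : (ρ N).mass = val h := by
      rw [← ENNReal.coe_inj, FiniteMeasure.ennreal_mass]; exact hu N
    exact this)
  have hσ' : Tendsto ρ (hyperfilter ℕ) (𝓝 σ) := hσ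
  rw [FiniteMeasure.tendsto_iff_forall_lintegral_tendsto] at hσ'
  refine ⟨σ, inferInstance, fun w => ?_⟩
  have h1 := hσ' (BoundedContinuousFunction.mkOfCompact ⟨wordMonomial w, continuous_wordMonomial w⟩)
  have h2 := (tendsto_lintegral_wordMonomial_freq X val hX hval w h).mono_left
    Nat.hyperfilter_le_atTop
  refine tendsto_nhds_unique h1 (h2.congr fun N => ?_)
  change _ = ∫⁻ x, (wordMonomial w x : ℝ≥0∞) ∂((countMeasure X val N h).map (freq N))
  rw [lintegral_map _ (hm N)]
  exact (continuous_wordMonomial w).measurable.coe_nnreal_ennreal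

end Hausdorff

section Determinacy
open Filter Topology NNReal

variable {ι : Type*} [Fintype ι]

lemma measurable_stdSimplex_apply (i : ι) : Measurable fun x : stdSimplex ℝ≥0 ι => x i :=
  (continuous_stdSimplex_apply i).measurable

lemma measurable_wordMonomial (w : List ι) :
    Measurable (wordMonomial w : stdSimplex ℝ≥0 ι → ℝ≥0) :=
  (continuous_wordMonomial w).measurable

/-- A finite measure on the simplex is determined by its moments. -/
theorem ext_of_lintegral_wordMonomial {ρ ρ' : Measure (stdSimplex ℝ≥0 ι)} [IsFiniteMeasure ρ]
    [IsFiniteMeasure ρ']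
    (h : ∀ w : List ι, ∫⁻ x, wordMonomial w x ∂ρ = ∫⁻ x, wordMonomial w x ∂ρ') : ρ = ρ' := by
  let co : ι → BoundedContinuousFunction (stdSimplex ℝ≥0 ι) ℝ := fun i =>
    BoundedContinuousFunction.mkOfCompact
      ⟨fun x => (x i : ℝ), NNReal.continuous_coe.comp (continuous_stdSimplex_apply i)⟩
  let A : StarSubalgebra ℝ (BoundedContinuousFunction (stdSimplex ℝ≥0 ι) ℝ) :=
    { Algebra.adjoin ℝ (Set.range co) with
      star_mem' := fun {a} ha => by
        have : star a = a := by ext x; simp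
        rw [this]; exact ha }
  refine ext_of_forall_mem_subalgebra_integral_eq_of_pseudoEMetric_complete_countable
    (𝕜 := ℝ) (A := A) ?_ ?_
  · intro x y hxy
    have : ∃ i, x i ≠ y i := by
      by_contra! hc
      exact hxy (stdSimplex.ext (funext hc))
    obtain ⟨i, hi⟩ := this
    refine ⟨co i, ⟨_, ⟨co i, Algebra.subset_adjoin ⟨i, rfl⟩, rfl⟩, rfl⟩, ?_⟩
    change (x i : ℝ) ≠ y i
    exact_mod_cast hi
  · intro g hg
    have hg' : g ∈ Algebra.adjoin ℝ (Set.range co) := hg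
    rw [← Subalgebra.mem_toSubmodule, Algebra.adjoin_eq_span] at hg'
    clear hg
    induction hg' using Submodule.span_induction with
    | mem g hgm =>
      have : ∃ w : List ι, ∀ x, g x = wordMonomial w x := by
        induction hgm using Submonoid.closure_induction with
        | mem g hg => obtain ⟨i, rfl⟩ := hg; exact ⟨[i], fun x => by simp [co]⟩
        | one => exact ⟨[], fun x => by simp⟩
        | mul a b _ _ iha ihb =>
          obtain ⟨w, hw⟩ := iha
          obtain ⟨w', hw'⟩ := ihb
          exact ⟨w ++ w', fun x => by simp [hw, hw', wordMonomial]⟩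
      obtain ⟨w, hw⟩ := this
      simp only [hw]
      have e : ∀ σ : Measure (stdSimplex ℝ≥0 ι), ∫ x, (wordMonomial w x : ℝ) ∂σ
          = (∫⁻ x, wordMonomial w x ∂σ).toReal := fun σ => by
        rw [integral_eq_lintegral_of_nonneg_ae (Eventually.of_forall fun x => NNReal.coe_nonneg _)
          (measurable_wordMonomial w).coe_nnreal_real.aestronglyMeasurable]
        simp
      rw [e, e, h]
    | zero => simp
    | add a b _ _ iha ihb =>
      have ha := iha
      have hb := ihb
      simp only [BoundedContinuousFunction.coe_add, Pi.add_apply]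
      rw [integral_add (a.integrable _) (b.integrable _),
        integral_add (a.integrable _) (b.integrable _), ha, hb]
    | smul r a _ iha =>
      simp only [BoundedContinuousFunction.coe_smul]
      rw [integral_smul, integral_smul, iha]

end Determinacy

section Arrays
open Filter Topology NNReal

/-- The total degree of a multi-index. -/
def deg (β : Fin 3 → ℕ) : ℕ := ∑ i, β i

@[simp] lemma deg_zero : deg 0 = 0 := by simp [deg]

@[simp] lemma deg_add_single (β : Fin 3 → ℕ) (i : Fin 3) : deg (β + Pi.single i 1) = deg β + 1 := by
  simp [deg, Finset.sum_add_distrib]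

@[simp] lemma deg_add_smul_single (β : Fin 3 → ℕ) (i : Fin 3) (j : ℕ) :
    deg (β + j • Pi.single i 1) = deg β + j := by
  simp [deg, Finset.sum_add_distrib, ← Finset.mul_sum]

lemma multiIndex_induction {p : (Fin 3 → ℕ) → Prop} (zero : p 0)
    (add : ∀ β i, p β → p (β + Pi.single i 1)) (β : Fin 3 → ℕ) : p β := by
  induction h : deg β generalizing β with
  | zero =>
    have : β = 0 := by
      funext i
      simpa using Finset.sum_eq_zero_iff.1 h i (Finset.mem_univ i)
    rwa [this]
  | succ n ih =>
    obtain ⟨i, -, hi⟩ : ∃ i ∈ Finset.univ, β i ≠ 0 :=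
      Finset.exists_ne_zero_of_sum_ne_zero (by change deg β ≠ 0; omega)
    have e : β = (β - Pi.single i 1) + Pi.single i 1 := by
      funext j
      by_cases hj : j = i
      · subst hj; simp; omega
      · simp [Pi.single_eq_of_ne hj]
    rw [e]
    refine add _ _ (ih _ ?_)
    rw [e, deg_add_single] at h
    omega

/-- The weight of the event that the next letter, among those recording either a record or a
fixed middle rank, is `i`. -/
noncomputable def nextLetter (i : Fin 3) (G : (Fin 3 → ℕ) → ℝ≥0∞) (β : Fin 3 → ℕ) : ℝ≥0∞ :=
  ∑' j : ℕ, ((deg β).ascFactorial j : ℝ≥0∞) * G (β + Pi.single i 1 + j • Pi.single 0 1)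

lemma nextLetter_comm (i i' : Fin 3) (G : (Fin 3 → ℕ) → ℝ≥0∞) :
    nextLetter i (nextLetter i' G) = nextLetter i' (nextLetter i G) := by
  funext β
  simp only [nextLetter, deg_add_smul_single, deg_add_single]
  refine tsum_congr fun j => ?_
  congr 1
  refine tsum_congr fun k => ?_
  congr 2
  abel

lemma nextLetter_swap (i i' : Fin 3) (G : (Fin 3 → ℕ) → ℝ≥0∞) (β : Fin 3 → ℕ) :
    nextLetter i G (β + Pi.single i' 1) = nextLetter i' G (β + Pi.single i 1) := by
  simp only [nextLetter, deg_add_single, add_right_comm]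

lemma ascFactorial_succ' (n k : ℕ) : n * (n + 1).ascFactorial k = n.ascFactorial (k + 1) := by
  rw [Nat.ascFactorial_succ, ← Nat.succ_ascFactorial]

lemma nextLetter_eq (i : Fin 3) (G : (Fin 3 → ℕ) → ℝ≥0∞) (β : Fin 3 → ℕ) :
    nextLetter i G β
      = G (β + Pi.single i 1) + deg β * nextLetter 0 G (β + Pi.single i 1) := by
  rw [nextLetter, tsum_eq_zero_add' ENNReal.summable, nextLetter, ← ENNReal.tsum_mul_left]
  simp only [Nat.ascFactorial_zero, Nat.cast_one, one_mul, zero_smul, add_zero, deg_add_single]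
  congr 1
  refine tsum_congr fun j => ?_
  rw [← ascFactorial_succ', ← mul_assoc]
  push_cast
  congr 2
  rw [succ_nsmul']
  abel

lemma eq_tsum_of_recursion {A B : (Fin 3 → ℕ) → ℝ≥0∞}
    (h : ∀ β, A β = B β + deg β * A (β + Pi.single 0 1)) (β : Fin 3 → ℕ)
    (h0 : Tendsto (fun j : ℕ => ((deg β).ascFactorial j : ℝ≥0∞) * A (β + j • Pi.single 0 1))
      atTop (𝓝 0)) :
    A β = ∑' j : ℕ, ((deg β).ascFactorial j : ℝ≥0∞) * B (β + j • Pi.single 0 1) := by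
  have key : ∀ J : ℕ, A β
      = ∑ j ∈ Finset.range J, ((deg β).ascFactorial j : ℝ≥0∞) * B (β + j • Pi.single 0 1)
        + ((deg β).ascFactorial J : ℝ≥0∞) * A (β + J • Pi.single 0 1) := by
    intro J
    induction J with
    | zero => simp
    | succ J ih =>
      rw [ih, Finset.sum_range_succ, h (β + J • Pi.single 0 1), Nat.ascFactorial_succ, succ_nsmul,
        ← add_assoc β]
      simp only [deg_add_smul_single]
      push_cast
      ring
  have lim := (ENNReal.summable.hasSum (f := fun j : ℕ =>
    ((deg β).ascFactorial j : ℝ≥0∞) * B (β + j • Pi.single 0 1))).tendsto_sum_nat.add h0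
  rw [add_zero] at lim
  exact tendsto_nhds_unique (tendsto_const_nhds.congr key) lim

/-- Finite solutions of the backward recursion of record counts. -/
structure IsHarmonic (G : (Fin 3 → ℕ) → ℝ≥0∞) : Prop where
  ne_top : ∀ β, G β ≠ ∞
  eq : ∀ β, G β = G (β + Pi.single 1 1) + G (β + Pi.single 2 1)
    + (deg β + 1 : ℕ) * G (β + Pi.single 0 1)

namespace IsHarmonic

variable {G : (Fin 3 → ℕ) → ℝ≥0∞}

lemma tendsto_ascFactorial (hG : IsHarmonic G) (β : Fin 3 → ℕ) :
    Tendsto (fun j : ℕ => ((deg β).ascFactorial j : ℝ≥0∞) * G (β + j • Pi.single 0 1))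
      atTop (𝓝 0) := by
  have b1 : ∀ j : ℕ, ((deg β + 1).ascFactorial j : ℝ≥0∞) * G (β + j • Pi.single 0 1) ≤ G β := by
    intro j
    induction j with
    | zero => simp
    | succ j ih =>
      refine le_trans ?_ ih
      rw [hG.eq (β + j • Pi.single 0 1), Nat.ascFactorial_succ, succ_nsmul, ← add_assoc β]
      simp only [deg_add_smul_single]
      push_cast
      rw [mul_comm ((deg β + 1 + j : ℝ≥0∞)), mul_assoc]
      gcongr
      rw [add_right_comm (deg β : ℝ≥0∞)]
      exact le_add_self
  have b2 : ∀ j : ℕ, j ≠ 0 → ((deg β).ascFactorial j : ℝ≥0∞) * G (β + j • Pi.single 0 1)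
      ≤ deg β * G β / j := by
    intro j hj
    rw [ENNReal.le_div_iff_mul_le (by simp [hj]) (by simp)]
    calc ((deg β).ascFactorial j : ℝ≥0∞) * G (β + j • Pi.single 0 1) * j
        ≤ ((deg β + j : ℕ) * ((deg β).ascFactorial j : ℝ≥0∞)) * G (β + j • Pi.single 0 1) := by
          rw [mul_comm, ← mul_assoc]
          gcongr
          omega
      _ = deg β * (((deg β + 1).ascFactorial j : ℝ≥0∞) * G (β + j • Pi.single 0 1)) := by
          rw [← mul_assoc]
          congr 1
          exact_mod_cast (Nat.succ_ascFactorial (deg β) j).symm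
      _ ≤ deg β * G β := by gcongr; exact b1 j
  have l : Tendsto (fun j : ℕ => deg β * G β / (j : ℝ≥0∞)) atTop (𝓝 0) :=
    ENNReal.Tendsto.const_div ENNReal.tendsto_nat_nhds_top (Or.inr
      (ENNReal.mul_ne_top (natCast_ne_top _) (hG.ne_top β))) |>.trans (by simp)
  refine tendsto_of_tendsto_of_tendsto_of_le_of_le' tendsto_const_nhds l
    (Eventually.of_forall fun _ => zero_le) ?_
  filter_upwards [eventually_ne_atTop 0] with j hj using b2 j hj

lemma sum_nextLetter (hG : IsHarmonic G) (β : Fin 3 → ℕ) : G β = ∑ i, nextLetter i G β := by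
  have h := eq_tsum_of_recursion (A := G)
    (B := fun β => G (β + Pi.single 0 1) + G (β + Pi.single 1 1) + G (β + Pi.single 2 1))
    (fun β => by rw [hG.eq β]; push_cast; ring) β (hG.tendsto_ascFactorial β)
  rw [h, Fin.sum_univ_three]
  simp only [nextLetter]
  rw [← ENNReal.summable.tsum_add ENNReal.summable, ← ENNReal.summable.tsum_add ENNReal.summable]
  refine tsum_congr fun j => ?_
  simp only [add_right_comm _ (j • _), mul_add]

lemma nextLetter (hG : IsHarmonic G) (i : Fin 3) : IsHarmonic (nextLetter i G) where
  ne_top β := ne_top_of_le_ne_top (hG.ne_top β) (by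
    rw [hG.sum_nextLetter β]
    exact Finset.single_le_sum (f := fun i => _root_.nextLetter i G β) (fun _ _ => zero_le)
      (Finset.mem_univ i))
  eq β := by
    rw [nextLetter_eq i, hG.sum_nextLetter, Fin.sum_univ_three, nextLetter_swap 0 i,
      nextLetter_swap 1 i, nextLetter_swap 2 i]
    push_cast
    ring

end IsHarmonic

end Arrays

section Representation
open Filter Topology NNReal

/-- The weight, under the law with parameters `x`, of a rank sequence with letter counts `β`. -/
noncomputable def countWeight (β : Fin 3 → ℕ) (x : stdSimplex ℝ≥0 (Fin 3)) : ℝ≥0 :=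
  (∏ i, x i ^ β i) / ∏ j ∈ Finset.range (deg β), (1 + j * x 0)

lemma countWeight_add_single_mul (β : Fin 3 → ℕ) (i : Fin 3) (x : stdSimplex ℝ≥0 (Fin 3)) :
    countWeight (β + Pi.single i 1) x * (1 + deg β * x 0) = x i * countWeight β x := by
  have h1 : ∏ i', x i' ^ (β + Pi.single i 1 : Fin 3 → ℕ) i' = x i * ∏ i', x i' ^ β i' := by
    simp only [Pi.add_apply, pow_add, Finset.prod_mul_distrib]
    rw [mul_comm]
    congr 1
    rw [Finset.prod_eq_single i]
    · simp
    · intro b _ hb; simp [Pi.single_eq_of_ne hb]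
    · simp
  have hp : (1 + deg β * x 0 : ℝ≥0) ≠ 0 := by positivity
  have hP : ∏ j ∈ Finset.range (deg β), (1 + j * x 0) ≠ 0 :=
    Finset.prod_ne_zero_iff.2 fun j _ => by positivity
  rw [countWeight, countWeight, h1, deg_add_single, Finset.prod_range_succ]
  field_simp
  simp only [mul_comm]

@[simp] lemma countWeight_zero (x : stdSimplex ℝ≥0 (Fin 3)) : countWeight 0 x = 1 := by
  simp [countWeight]

lemma measurable_countWeight (β : Fin 3 → ℕ) : Measurable (countWeight β) := by
  have h := fun i => measurable_stdSimplex_apply (ι := Fin 3) i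
  exact (Finset.measurable_fun_prod _ fun i _ => (h i).pow_const _).div
    (Finset.measurable_fun_prod _ fun j _ => ((h 0).const_mul _).const_add _)

lemma isHarmonic_countWeight (x : stdSimplex ℝ≥0 (Fin 3)) :
    IsHarmonic fun β => (countWeight β x : ℝ≥0∞) where
  ne_top β := ENNReal.coe_ne_top
  eq β := by
    have h : ∀ i, countWeight (β + Pi.single i 1) x
        = x i * countWeight β x / (1 + deg β * x 0) := fun i => by
      rw [_root_.eq_div_iff (by positivity), countWeight_add_single_mul]
    have hs := stdSimplex.sum_eq_one x
    rw [Fin.sum_univ_three] at hs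
    norm_cast
    simp only [h]
    rw [mul_div_assoc', ← add_div, ← add_div, _root_.eq_div_iff (by positivity)]
    push_cast
    calc countWeight β x * (1 + deg β * x 0)
        = countWeight β x * ((x 0 + x 1 + x 2) + deg β * x 0) := by rw [hs]
      _ = _ := by ring

lemma apply_mul_countWeight_eq_tsum (β : Fin 3 → ℕ) (i : Fin 3) (x : stdSimplex ℝ≥0 (Fin 3)) :
    (x i * countWeight β x : ℝ≥0∞) = ∑' j : ℕ, ((deg β).ascFactorial j : ℝ≥0∞) *
      countWeight (β + Pi.single i 1 + j • Pi.single 0 1) x := by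
  have h := eq_tsum_of_recursion (A := fun β => (x i * countWeight β x : ℝ≥0∞))
    (B := fun β => (countWeight (β + Pi.single i 1) x : ℝ≥0∞)) (fun β => by
      norm_cast
      have hp : (1 + deg β * x 0 : ℝ≥0) ≠ 0 := by positivity
      have e1 := countWeight_add_single_mul β i x
      have e0 := countWeight_add_single_mul β 0 x
      have e : x i * countWeight (β + Pi.single 0 1) x = x 0 * countWeight (β + Pi.single i 1) x := by
        refine mul_right_cancel₀ hp ?_
        rw [mul_assoc, mul_assoc, e0, e1, mul_left_comm]
      rw [e, ← e1]
      ring) β (by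
      have := (isHarmonic_countWeight x).tendsto_ascFactorial β
      have := ENNReal.Tendsto.const_mul (a := (x i : ℝ≥0∞)) this (Or.inr ENNReal.coe_ne_top)
      rw [mul_zero] at this
      refine this.congr fun j => ?_
      ring)
  rw [h]
  simp only [add_right_comm]

/-- The array of weights of a mixture. -/
noncomputable def mixWeight (ρ : Measure (stdSimplex ℝ≥0 (Fin 3)))
    (f : stdSimplex ℝ≥0 (Fin 3) → ℝ≥0∞) (β : Fin 3 → ℕ) : ℝ≥0∞ :=
  ∫⁻ x, f x * countWeight β x ∂ρ

lemma nextLetter_mixWeight (ρ : Measure (stdSimplex ℝ≥0 (Fin 3)))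
    {f : stdSimplex ℝ≥0 (Fin 3) → ℝ≥0∞} (hf : Measurable f) (i : Fin 3) :
    nextLetter i (mixWeight ρ f) = mixWeight ρ (fun x => x i * f x) := by
  funext β
  have hm := fun β => (measurable_countWeight β).coe_nnreal_ennreal
  have hm' : ∀ j : ℕ, Measurable fun x =>
      f x * (countWeight (β + Pi.single i 1 + j • Pi.single 0 1) x : ℝ≥0∞) := fun j => hf.mul (hm _)
  calc nextLetter i (mixWeight ρ f) β
      = ∑' j : ℕ, ∫⁻ x, ((deg β).ascFactorial j : ℝ≥0∞) *
        (f x * countWeight (β + Pi.single i 1 + j • Pi.single 0 1) x) ∂ρ :=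
        tsum_congr fun j => (lintegral_const_mul _ (hm' j)).symm
    _ = ∫⁻ x, ∑' j : ℕ, ((deg β).ascFactorial j : ℝ≥0∞) *
        (f x * countWeight (β + Pi.single i 1 + j • Pi.single 0 1) x) ∂ρ :=
        (lintegral_tsum fun j => ((hm' j).const_mul _).aemeasurable).symm
    _ = mixWeight ρ (fun x => x i * f x) β := lintegral_congr fun x => by
        rw [mul_right_comm, apply_mul_countWeight_eq_tsum, ← ENNReal.tsum_mul_right]
        refine tsum_congr fun j => ?_
        ring

lemma foldl_nextLetter_mixWeight (ρ : Measure (stdSimplex ℝ≥0 (Fin 3))) (w : List (Fin 3))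
    {f : stdSimplex ℝ≥0 (Fin 3) → ℝ≥0∞} (hf : Measurable f) :
    w.foldl (fun G i => nextLetter i G) (mixWeight ρ f)
      = mixWeight ρ (fun x => wordMonomial w x * f x) := by
  induction w generalizing f with
  | nil => simp
  | cons i w ih =>
    rw [List.foldl_cons, nextLetter_mixWeight ρ hf,
      ih (f := fun x => x i * f x) ((measurable_stdSimplex_apply i).coe_nnreal_ennreal.mul hf)]
    congr 1
    funext x
    simp only [wordMonomial_cons, ENNReal.coe_mul]
    ring

/-- A finite measure on the simplex is determined by its mixed count weights. -/
theorem ext_of_lintegral_countWeight {ρ ρ' : Measure (stdSimplex ℝ≥0 (Fin 3))} [IsFiniteMeasure ρ]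
    [IsFiniteMeasure ρ'] (h : ∀ β, ∫⁻ x, countWeight β x ∂ρ = ∫⁻ x, countWeight β x ∂ρ') :
    ρ = ρ' := by
  have e : mixWeight ρ (fun _ => 1) = mixWeight ρ' (fun _ => 1) := by
    funext β; simpa [mixWeight] using h β
  refine ext_of_lintegral_wordMonomial fun w => ?_
  have h1 := foldl_nextLetter_mixWeight ρ w (measurable_const (a := (1 : ℝ≥0∞)))
  have h2 := foldl_nextLetter_mixWeight ρ' w (measurable_const (a := (1 : ℝ≥0∞)))
  have := congrFun ((h1.symm.trans (congrArg (fun G => w.foldl (fun G i => nextLetter i G) G) e)).trans h2) 0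
  simpa [mixWeight] using this

/-- Every harmonic array is a mixture of count weights. -/
theorem IsHarmonic.exists_measure {G : (Fin 3 → ℕ) → ℝ≥0∞} (hG : IsHarmonic G) :
    ∃ ρ : Measure (stdSimplex ℝ≥0 (Fin 3)), IsFiniteMeasure ρ ∧
      (∀ β, G β = ∫⁻ x, countWeight β x ∂ρ) := by
  let H := {G : (Fin 3 → ℕ) → ℝ≥0∞ // IsHarmonic G}
  let X : Fin 3 → H → H := fun i F => ⟨_root_.nextLetter i F.1, F.2.nextLetter i⟩
  have hX : ∀ i j F, X i (X j F) = X j (X i F) := fun i j F => Subtype.ext (nextLetter_comm i j F.1)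
  let val : (Fin 3 → ℕ) → H → ℝ≥0 := fun β F => (F.1 β).toNNReal
  have hval_coe : ∀ β F, (val β F : ℝ≥0∞) = F.1 β := fun β F => ENNReal.coe_toNNReal (F.2.ne_top β)
  have hval : ∀ β F, val β F = ∑ i, val β (X i F) := fun β F => by
    rw [← ENNReal.coe_inj]
    push_cast
    simp only [hval_coe]
    exact F.2.sum_nextLetter β
  choose ρ hfin hρ using fun β => exists_measure_lintegral_wordMonomial X (val β) hX (hval β) ⟨G, hG⟩
  have hco := fun i => (measurable_stdSimplex_apply (ι := Fin 3) i).coe_nnreal_ennreal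
  have rel : ∀ β i, (ρ β).withDensity (fun x => (x i : ℝ≥0∞))
      = (ρ (β + Pi.single i 1)).withDensity (fun x => ((1 + deg β * x 0 : ℝ≥0) : ℝ≥0∞)) := by
    intro β i
    have m2 : Measurable fun x : stdSimplex ℝ≥0 (Fin 3) => ((1 + deg β * x 0 : ℝ≥0) : ℝ≥0∞) :=
      ((measurable_stdSimplex_apply 0).const_mul _ |>.const_add _).coe_nnreal_ennreal
    have := isFiniteMeasure_withDensity (μ := ρ β) (f := fun x => (x i : ℝ≥0∞)) (by
      rw [lintegral_congr fun x => (by simp : (x i : ℝ≥0∞) = wordMonomial [i] x), hρ]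
      exact ENNReal.coe_ne_top)
    have := isFiniteMeasure_withDensity (μ := ρ (β + Pi.single i 1))
      (f := fun x => ((1 + deg β * x 0 : ℝ≥0) : ℝ≥0∞)) (by
      refine (IsFiniteMeasure.lintegral_lt_top_of_bounded_to_ennreal _
        ⟨1 + deg β, fun x => ?_⟩).ne
      gcongr
      exact mul_le_of_le_one_right zero_le (stdSimplex.le_one x 0))
    refine ext_of_lintegral_wordMonomial fun w => ?_
    have mw := (measurable_wordMonomial (ι := Fin 3) w).coe_nnreal_ennreal
    rw [lintegral_withDensity_eq_lintegral_mul _ (hco i) mw,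
      lintegral_withDensity_eq_lintegral_mul _ m2 mw]
    have h1 := hρ β (w ++ [i])
    have h2 := hρ (β + Pi.single i 1) w
    have h3 := hρ (β + Pi.single i 1) (w ++ [0])
    rw [List.foldl_append, hval_coe] at h1 h3
    rw [hval_coe] at h2
    simp only [List.foldl_cons, List.foldl_nil] at h1 h3
    have h4 := nextLetter_eq i (w.foldl (fun F i => X i F) ⟨G, hG⟩ : H).1 β
    change (X i (w.foldl (fun F i => X i F) ⟨G, hG⟩)).1 β = _ at h4
    change _ = _ + _ * (X 0 (w.foldl (fun F i => X i F) ⟨G, hG⟩)).1 _ at h4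
    rw [← h1, ← h2, ← h3, ← lintegral_const_mul _ (by
      exact (measurable_wordMonomial (ι := Fin 3) _).coe_nnreal_ennreal),
      ← lintegral_add_left mw] at h4
    refine Eq.trans (lintegral_congr fun x => ?_) (h4.trans (lintegral_congr fun x => ?_))
    · simp [wordMonomial, mul_comm]
    · simp [wordMonomial]; ring
  have main : ∀ β (f : stdSimplex ℝ≥0 (Fin 3) → ℝ≥0∞), Measurable f →
      ∫⁻ x, f x ∂ρ β = ∫⁻ x, f x * countWeight β x ∂ρ 0 := by
    intro β
    induction β using multiIndex_induction with
    | zero => simp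
    | add β i ih =>
      intro f hf
      have m2 : Measurable fun x : stdSimplex ℝ≥0 (Fin 3) => ((1 + deg β * x 0 : ℝ≥0) : ℝ≥0∞) :=
        ((measurable_stdSimplex_apply 0).const_mul _ |>.const_add _).coe_nnreal_ennreal
      have mg : Measurable fun x : stdSimplex ℝ≥0 (Fin 3) =>
        ((1 + deg β * x 0 : ℝ≥0) : ℝ≥0∞)⁻¹ * f x := m2.inv.mul hf
      have h := congrArg (fun σ => ∫⁻ x, ((1 + deg β * x 0 : ℝ≥0) : ℝ≥0∞)⁻¹ * f x ∂σ) (rel β i)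
      rw [lintegral_withDensity_eq_lintegral_mul _ (hco i) mg,
        lintegral_withDensity_eq_lintegral_mul _ m2 mg] at h
      rw [ih _ ((hco i).mul mg)] at h
      simp only [Pi.mul_apply] at h
      have hne : ∀ x : stdSimplex ℝ≥0 (Fin 3), ((1 + deg β * x 0 : ℝ≥0) : ℝ≥0∞) ≠ 0 := fun x => by
        rw [Ne, ENNReal.coe_eq_zero]; positivity
      refine Eq.trans (lintegral_congr fun x => ?_) (h.symm.trans (lintegral_congr fun x => ?_))
      · rw [← mul_assoc, ENNReal.mul_inv_cancel (hne x) ENNReal.coe_ne_top, one_mul]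
      · have := congrArg (ENNReal.ofNNReal) (countWeight_add_single_mul β i x)
        rw [ENNReal.coe_mul, ENNReal.coe_mul] at this
        rw [mul_right_comm, ← this, ← mul_assoc, mul_assoc _ _ (_⁻¹),
          ENNReal.mul_inv_cancel (hne x) ENNReal.coe_ne_top, mul_one, mul_comm]
  refine ⟨ρ 0, hfin 0, fun β => ?_⟩
  have h1 := hρ β []
  have h2 := main β 1 measurable_one
  simp only [Pi.one_apply, one_mul] at h2
  rw [← h2]
  rw [hval_coe] at h1
  simpa using h1.symm

end Representation

section RecordCounts

/-- The letter of a rank: `1` for a lower record, `2` for an upper record, `0` otherwise. -/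
def rankLetter (j : ℕ) (v : Fin (j + 1)) : Fin 3 :=
  if v.val = 0 then 1 else if v.val = j then 2 else 0

/-- The letter counts of the `s` ranks following the first two. -/
def letterCount (ω : RankSpace) (s : ℕ) : Fin 3 → ℕ :=
  ∑ j ∈ Finset.range s, Pi.single (rankLetter (j + 2) (ω (j + 2))) 1

/-- The cylinder spanned by the first `n` coordinates of `ω`. -/
def prefixCyl (ω : RankSpace) (n : ℕ) : Set RankSpace := rankCyl (n := n) fun j => ω j

@[simp] lemma letterCount_zero (ω : RankSpace) : letterCount ω 0 = 0 := by simp [letterCount]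

lemma letterCount_succ (ω : RankSpace) (s : ℕ) : letterCount ω (s + 1)
    = letterCount ω s + Pi.single (rankLetter (s + 2) (ω (s + 2))) 1 :=
  Finset.sum_range_succ _ _

@[simp] lemma deg_letterCount (ω : RankSpace) (s : ℕ) : deg (letterCount ω s) = s := by
  induction s with
  | zero => simp
  | succ s ih => rw [letterCount_succ, deg_add_single, ih]

lemma letterCount_congr {ω ω' : RankSpace} {s : ℕ} (h : ∀ j < s + 2, ω j = ω' j) :
    letterCount ω s = letterCount ω' s :=
  Finset.sum_congr rfl fun j hj => by rw [h _ (by simpa using hj)]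

lemma letterCount_update_succ (ω : RankSpace) (s : ℕ) (v : Fin (s + 2 + 1)) :
    letterCount (Function.update ω (s + 2) v) (s + 1)
      = letterCount ω s + Pi.single (rankLetter (s + 2) v) 1 := by
  rw [letterCount_succ, Function.update_self]
  congr 1
  exact letterCount_congr fun j hj => Function.update_of_ne hj.ne _ _

lemma card_filter_lower (ω : RankSpace) (s : ℕ) :
    (Finset.univ.filter fun j : Fin (s + 2) => 1 ≤ j.val ∧ (ω j).val = 0).card
      = (if (ω 1).val = 0 then 1 else 0) + letterCount ω s 1 := by
  rw [Finset.card_filter, Fin.sum_univ_eq_sum_range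
    (fun j => if 1 ≤ j ∧ (ω j).val = 0 then 1 else 0)]
  induction s with
  | zero => rw [Finset.sum_range_succ, Finset.sum_range_one]; simp
  | succ s ih =>
    rw [Finset.sum_range_succ, ih, letterCount_succ, add_assoc]
    congr 1
    simp only [Pi.add_apply, Pi.single_apply, rankLetter]
    split_ifs <;> simp_all

lemma card_filter_upper (ω : RankSpace) (s : ℕ) :
    (Finset.univ.filter fun j : Fin (s + 2) => 1 ≤ j.val ∧ (ω j).val = j.val).card
      = (if (ω 1).val = 0 then 0 else 1) + letterCount ω s 2 := by
  rw [Finset.card_filter, Fin.sum_univ_eq_sum_range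
    (fun j => if 1 ≤ j ∧ (ω j).val = j then 1 else 0)]
  induction s with
  | zero =>
    have h := (ω 1).isLt
    rw [Finset.sum_range_succ, Finset.sum_range_one, letterCount_zero, Pi.zero_apply]
    split_ifs <;> omega
  | succ s ih =>
    rw [Finset.sum_range_succ, ih, letterCount_succ, add_assoc]
    congr 1
    simp only [Pi.add_apply, Pi.single_apply, rankLetter]
    split_ifs <;> simp_all

lemma exists_letterCount_eq (δ : Fin 2) (β : Fin 3 → ℕ) :
    ∃ ω : RankSpace, ω 1 = δ ∧ letterCount ω (deg β) = β := by
  induction β using multiIndex_induction with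
  | zero => exact ⟨Function.update 0 1 δ, by simp, by simp⟩
  | add β i ih =>
    obtain ⟨ω, h1, h⟩ := ih
    obtain ⟨v, hv⟩ : ∃ v, rankLetter (deg β + 2) v = i := by
      fin_cases i
      · exact ⟨⟨1, by omega⟩, by simp [rankLetter]⟩
      · exact ⟨0, by simp [rankLetter]⟩
      · exact ⟨Fin.last _, by simp [rankLetter]⟩
    refine ⟨Function.update ω (deg β + 2) v, ?_, ?_⟩
    · rw [Function.update_of_ne (by omega), h1]
    · rw [deg_add_single, letterCount_update_succ, h, hv]

lemma mem_prefixCyl {ω ω' : RankSpace} {n : ℕ} : ω' ∈ prefixCyl ω n ↔ ∀ j < n, ω' j = ω j :=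
  ⟨fun h j hj => h ⟨j, hj⟩, fun h j => h j j.2⟩

lemma measurableSet_prefixCyl (ω : RankSpace) (n : ℕ) : MeasurableSet (prefixCyl ω n) := by
  have : prefixCyl ω n = ⋂ j : Fin n, (fun ω' : RankSpace => ω' j) ⁻¹' {ω j} := by
    ext ω'; simp [prefixCyl, rankCyl]
  rw [this]
  exact MeasurableSet.iInter fun j => measurable_pi_apply (j : ℕ) (measurableSet_singleton _)

lemma measure_prefixCyl_eq_sum (P : Measure RankSpace) (ω : RankSpace) (n : ℕ) :
    P (prefixCyl ω n) = ∑ v, P (prefixCyl (Function.update ω n v) (n + 1)) := by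
  have : prefixCyl ω n = ⋃ v, prefixCyl (Function.update ω n v) (n + 1) := by
    ext ω'
    simp only [Set.mem_iUnion, mem_prefixCyl]
    constructor
    · intro h
      refine ⟨ω' n, fun j hj => ?_⟩
      rcases Nat.lt_succ_iff_lt_or_eq.1 hj with hj | rfl
      · rw [Function.update_of_ne hj.ne, h j hj]
      · simp
    · rintro ⟨v, h⟩ j hj
      rw [h j (by omega), Function.update_of_ne hj.ne]
  rw [this, measure_iUnion _ fun v => measurableSet_prefixCyl _ _, tsum_fintype]
  intro v v' hv
  refine Set.disjoint_left.2 fun ω' h h' => hv ?_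
  have h1 := mem_prefixCyl.1 h n (by omega)
  have h2 := mem_prefixCyl.1 h' n (by omega)
  rw [Function.update_self] at h1 h2
  exact h1.symm.trans h2

/-- Cylinder probabilities are functions of the numbers of lower and upper records. -/
def IsRecordUniform (P : Measure RankSpace) : Prop :=
  ∀ (n : ℕ) (i i' : (j : Fin n) → Fin (j.val + 1)),
    (Finset.univ.filter fun j : Fin n => 1 ≤ j.val ∧ (i j).val = 0).card
      = (Finset.univ.filter fun j : Fin n => 1 ≤ j.val ∧ (i' j).val = 0).card →
    (Finset.univ.filter fun j : Fin n => 1 ≤ j.val ∧ (i j).val = j.val).card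
      = (Finset.univ.filter fun j : Fin n => 1 ≤ j.val ∧ (i' j).val = j.val).card →
    P (rankCyl i) = P (rankCyl i')

/-- The common probability of the cylinders with second rank `δ` and letter counts `β`. -/
noncomputable def cylArray (P : Measure RankSpace) (δ : Fin 2) (β : Fin 3 → ℕ) : ℝ≥0∞ :=
  P (prefixCyl (exists_letterCount_eq δ β).choose (deg β + 2))

variable {P : Measure RankSpace}

lemma IsRecordUniform.measure_prefixCyl_congr (hP : IsRecordUniform P) {ω ω' : RankSpace} {s : ℕ}
    (h1 : (if (ω 1).val = 0 then 1 else 0) + letterCount ω s 1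
      = (if (ω' 1).val = 0 then 1 else 0) + letterCount ω' s 1)
    (h2 : (if (ω 1).val = 0 then 0 else 1) + letterCount ω s 2
      = (if (ω' 1).val = 0 then 0 else 1) + letterCount ω' s 2) :
    P (prefixCyl ω (s + 2)) = P (prefixCyl ω' (s + 2)) :=
  hP (s + 2) _ _ (by rw [card_filter_lower, card_filter_lower, h1])
    (by rw [card_filter_upper, card_filter_upper, h2])

lemma IsRecordUniform.measure_prefixCyl (hP : IsRecordUniform P) (ω : RankSpace) (s : ℕ) :
    P (prefixCyl ω (s + 2)) = cylArray P (ω 1) (letterCount ω s) := by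
  obtain ⟨h1, h⟩ := (exists_letterCount_eq (ω 1) (letterCount ω s)).choose_spec
  rw [cylArray]
  generalize (exists_letterCount_eq (ω 1) (letterCount ω s)).choose = ω' at *
  rw [deg_letterCount] at h ⊢
  refine hP.measure_prefixCyl_congr ?_ ?_ <;> rw [h1, h]

lemma IsRecordUniform.isHarmonic_cylArray [IsFiniteMeasure P] (hP : IsRecordUniform P)
    (δ : Fin 2) : IsHarmonic (cylArray P δ) where
  ne_top β := measure_ne_top _ _
  eq β := by
    obtain ⟨ω, rfl, h⟩ := exists_letterCount_eq δ β
    have key : ∀ v : Fin (deg β + 2 + 1), P (prefixCyl (Function.update ω (deg β + 2) v)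
        (deg β + 2 + 1)) = cylArray P (ω 1) (β + Pi.single (rankLetter (deg β + 2) v) 1) := by
      intro v
      have := hP.measure_prefixCyl (Function.update ω (deg β + 2) v) (deg β + 1)
      rwa [letterCount_update_succ, h, Function.update_of_ne (by omega)] at this
    have h0 := hP.measure_prefixCyl ω (deg β)
    rw [h, measure_prefixCyl_eq_sum] at h0
    rw [← h0]
    simp only [key]
    rw [Fin.sum_univ_succ, Fin.sum_univ_castSucc]
    have hm : ∀ v : Fin (deg β + 1), rankLetter (deg β + 2) v.castSucc.succ = 0 := fun v => by
      have := v.isLt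
      simp [rankLetter]
      omega
    simp only [hm, Finset.sum_const, Finset.card_univ, Fintype.card_fin, nsmul_eq_mul]
    rw [show rankLetter (deg β + 2) 0 = 1 by simp [rankLetter],
      show rankLetter (deg β + 2) (Fin.last (deg β + 1)).succ = 2 by simp [rankLetter]]
    ring

lemma IsRecordUniform.cylArray_zero_add (hP : IsRecordUniform P) (β : Fin 3 → ℕ) :
    cylArray P 0 (β + Pi.single 2 1) = cylArray P 1 (β + Pi.single 1 1) := by
  obtain ⟨ω, h1, h⟩ := exists_letterCount_eq 0 (β + Pi.single 2 1)
  obtain ⟨ω', h1', h'⟩ := exists_letterCount_eq 1 (β + Pi.single 1 1)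
  rw [deg_add_single] at h h'
  rw [← h, ← h', ← h1, ← h1', ← hP.measure_prefixCyl, ← hP.measure_prefixCyl]
  refine hP.measure_prefixCyl_congr ?_ ?_ <;> rw [h, h', h1, h1'] <;> simp [add_comm]

lemma IsRecordUniform.cylArray_zero_zero [IsProbabilityMeasure P] (hP : IsRecordUniform P) :
    cylArray P 0 0 + cylArray P 1 0 = 1 := by
  have h : P (prefixCyl 0 1) = 1 := by
    have : prefixCyl 0 1 = Set.univ := by
      ext ω
      simp only [mem_prefixCyl, Set.mem_univ, iff_true]
      intro j hj
      obtain rfl : j = 0 := by omega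
      exact Subsingleton.elim (α := Fin 1) _ _
    rw [this, measure_univ]
  rw [measure_prefixCyl_eq_sum] at h
  have key : ∀ v, P (prefixCyl (Function.update (0 : RankSpace) 1 v) (1 + 1)) = cylArray P v 0 := by
    intro v
    have := hP.measure_prefixCyl (Function.update (0 : RankSpace) 1 v) 0
    rwa [letterCount_zero, Function.update_self] at this
  simp only [key] at h
  rwa [Fin.sum_univ_two] at h

end RecordCounts

section Parameters
open NNReal

lemma stdSimplex_ext_zero_one {x y : stdSimplex ℝ≥0 (Fin 3)} (h0 : x 0 = y 0) (h1 : x 1 = y 1) :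
    x = y := by
  have hx := stdSimplex.sum_eq_one x
  have hy := stdSimplex.sum_eq_one y
  rw [Fin.sum_univ_three] at hx hy
  have h2 : x 2 = y 2 := by
    rw [h0, h1] at hx
    exact add_left_cancel (hx.trans hy.symm)
  refine Subtype.ext (funext fun i => ?_)
  fin_cases i
  exacts [h0, h1, h2]

/-- The simplex coordinate `1 / (1 + η)`. -/
noncomputable def middleWeight (η : ℝ≥0∞) : ℝ≥0 := ((1 + η)⁻¹).toNNReal

/-- The truncation of a real number to the unit interval. -/
noncomputable def unitClip (p : ℝ) : ℝ≥0 := min p.toNNReal 1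

lemma coe_middleWeight (η : ℝ≥0∞) : (middleWeight η : ℝ≥0∞) = (1 + η)⁻¹ :=
  ENNReal.coe_toNNReal (by simp)

lemma middleWeight_le_one (η : ℝ≥0∞) : middleWeight η ≤ 1 := by
  rw [← ENNReal.coe_le_coe, coe_middleWeight, ENNReal.coe_one, ENNReal.inv_le_one]
  exact le_self_add

lemma unitClip_le_one (p : ℝ) : unitClip p ≤ 1 := min_le_right _ _

lemma coe_unitClip {p : ℝ} (hp : p ∈ Set.Icc (0 : ℝ) 1) : (unitClip p : ℝ) = p := by
  rw [unitClip, min_eq_left (Real.toNNReal_le_one.2 hp.2), Real.coe_toNNReal _ hp.1]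

lemma ofReal_eq_unitClip {p : ℝ} (hp : p ∈ Set.Icc (0 : ℝ) 1) :
    ENNReal.ofReal p = unitClip p := by
  rw [← ENNReal.ofReal_coe_nnreal, coe_unitClip hp]

lemma ofReal_one_sub_eq_unitClip {p : ℝ} (hp : p ∈ Set.Icc (0 : ℝ) 1) :
    ENNReal.ofReal (1 - p) = (1 - unitClip p : ℝ≥0) := by
  rw [← ENNReal.ofReal_coe_nnreal, NNReal.coe_sub (unitClip_le_one p), coe_unitClip hp,
    NNReal.coe_one]

/-- The simplex coordinates `(1 / (1 + η), p η / (1 + η), (1 - p) η / (1 + η))`. -/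
noncomputable def toSimplex (q : ℝ≥0∞ × ℝ) : stdSimplex ℝ≥0 (Fin 3) :=
  ⟨![middleWeight q.1, (1 - middleWeight q.1) * unitClip q.2,
    (1 - middleWeight q.1) * (1 - unitClip q.2)], fun _ => zero_le, by
    rw [Fin.sum_univ_three]
    simp only [Matrix.cons_val]
    rw [add_assoc, ← mul_add, add_tsub_cancel_of_le (unitClip_le_one _), mul_one,
      add_tsub_cancel_of_le (middleWeight_le_one _)]⟩

lemma toSimplex_zero (q : ℝ≥0∞ × ℝ) : toSimplex q 0 = middleWeight q.1 := rfl

lemma toSimplex_one (q : ℝ≥0∞ × ℝ) : toSimplex q 1 = (1 - middleWeight q.1) * unitClip q.2 := rfl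

lemma toSimplex_two (q : ℝ≥0∞ × ℝ) :
    toSimplex q 2 = (1 - middleWeight q.1) * (1 - unitClip q.2) := rfl

lemma measurable_toSimplex : Measurable toSimplex := by
  have h1 : Measurable fun q : ℝ≥0∞ × ℝ => middleWeight q.1 :=
    (measurable_fst.const_add 1).inv.ennreal_toNNReal
  have h2 : Measurable fun q : ℝ≥0∞ × ℝ => unitClip q.2 :=
    measurable_snd.real_toNNReal.min measurable_const
  refine Measurable.subtype_mk (measurable_pi_iff.2 fun i => ?_)
  fin_cases i
  exacts [h1, (h1.const_sub 1).mul h2, (h1.const_sub 1).mul (h2.const_sub 1)]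

/-- The parameters `(η, p)` of a point of the simplex, with `p = c` when `η = 0`. -/
noncomputable def ofSimplex (c : ℝ) (x : stdSimplex ℝ≥0 (Fin 3)) : ℝ≥0∞ × ℝ :=
  ((x 0 : ℝ≥0∞)⁻¹ - 1, if x 0 < 1 then ((x 1 / (1 - x 0) : ℝ≥0) : ℝ) else c)

lemma measurable_ofSimplex (c : ℝ) : Measurable (ofSimplex c) := by
  have h := fun i => measurable_stdSimplex_apply (ι := Fin 3) i
  refine ((h 0).coe_nnreal_ennreal.inv.sub_const 1).prodMk (Measurable.ite ?_ ?_ measurable_const)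
  · exact measurableSet_lt (h 0) measurable_const
  · exact ((h 1).div ((h 0).const_sub 1)).coe_nnreal_real

lemma apply_one_le (x : stdSimplex ℝ≥0 (Fin 3)) : x 1 ≤ 1 - x 0 := by
  have hx := stdSimplex.sum_eq_one x
  rw [Fin.sum_univ_three] at hx
  rw [← hx, add_assoc, add_tsub_cancel_left]
  exact le_self_add

lemma apply_two_eq (x : stdSimplex ℝ≥0 (Fin 3)) : x 2 = 1 - x 0 - x 1 := by
  have hx := stdSimplex.sum_eq_one x
  rw [Fin.sum_univ_three] at hx
  rw [← hx, add_assoc, add_tsub_cancel_left, add_tsub_cancel_left]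

lemma ofSimplex_snd_mem {c : ℝ} (hc : c ∈ Set.Icc (0 : ℝ) 1) (x : stdSimplex ℝ≥0 (Fin 3)) :
    (ofSimplex c x).2 ∈ Set.Icc (0 : ℝ) 1 := by
  simp only [ofSimplex]
  split_ifs with h
  · refine ⟨NNReal.coe_nonneg _, ?_⟩
    rw [← NNReal.coe_one, NNReal.coe_le_coe]
    exact div_le_one_of_le₀ (apply_one_le x) zero_le
  · exact hc

lemma toSimplex_ofSimplex {c : ℝ} (hc : c ∈ Set.Icc (0 : ℝ) 1) (x : stdSimplex ℝ≥0 (Fin 3)) :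
    toSimplex (ofSimplex c x) = x := by
  have h0 : middleWeight (ofSimplex c x).1 = x 0 := by
    rw [← ENNReal.coe_inj, coe_middleWeight, ofSimplex, add_tsub_cancel_of_le, inv_inv]
    rw [ENNReal.one_le_inv]
    exact_mod_cast stdSimplex.le_one x 0
  refine stdSimplex_ext_zero_one h0 ?_
  rw [toSimplex_one, h0, ← NNReal.coe_inj, NNReal.coe_mul, coe_unitClip (ofSimplex_snd_mem hc x)]
  simp only [ofSimplex]
  split_ifs with h
  · rw [← NNReal.coe_mul, NNReal.coe_inj, mul_div_cancel₀]
    exact (tsub_pos_of_lt h).ne'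
  · have h1 : 1 - x 0 = 0 := tsub_eq_zero_of_le (not_lt.1 h)
    have h2 := apply_one_le x
    rw [h1] at h2 ⊢
    simp [le_antisymm h2 zero_le]

lemma ofSimplex_toSimplex {c : ℝ} {q : ℝ≥0∞ × ℝ} (hq : q.2 ∈ Set.Icc (0 : ℝ) 1)
    (h : q.1 ≠ 0 ∨ q.2 = c) : ofSimplex c (toSimplex q) = q := by
  refine Prod.ext ?_ ?_
  · simp only [ofSimplex]
    rw [toSimplex_zero, coe_middleWeight, inv_inv, ENNReal.add_sub_cancel_left ENNReal.one_ne_top]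
  · simp only [ofSimplex]
    rw [toSimplex_zero, toSimplex_one]
    split_ifs with h1
    · rw [mul_div_cancel_left₀ _ (tsub_pos_of_lt h1).ne', coe_unitClip hq]
    · refine (h.resolve_left fun h2 => h1 ?_).symm
      rw [← ENNReal.coe_lt_coe, coe_middleWeight, ENNReal.coe_one, ENNReal.inv_lt_one]
      exact ENNReal.lt_add_right ENNReal.one_ne_top h2

lemma ofSimplex_mem_extremeParams {c : ℝ} (hc : c = 0 ∨ c = 1) (x : stdSimplex ℝ≥0 (Fin 3)) :
    ofSimplex c x ∈ extremeParams := by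
  have hc' : c ∈ Set.Icc (0 : ℝ) 1 := by rcases hc with rfl | rfl <;> simp
  refine ⟨⟨trivial, ofSimplex_snd_mem hc' x⟩, ?_⟩
  rintro ⟨h1, h2⟩
  simp only [ofSimplex, Set.mem_singleton_iff, tsub_eq_zero_iff_le, ENNReal.inv_le_one] at h1 h2
  rw [if_neg (not_lt.2 (by exact_mod_cast h1))] at h2
  rcases hc with rfl | rfl <;> simp at h2

/-- The probability of the second rank `δ`. -/
noncomputable def secondWeight (δ : Fin 2) (p : ℝ) : ℝ≥0∞ :=
  if δ.val = 0 then ENNReal.ofReal p else ENNReal.ofReal (1 - p)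

lemma measurable_secondWeight (δ : Fin 2) : Measurable (secondWeight δ) := by
  unfold secondWeight
  split_ifs
  · exact ENNReal.measurable_ofReal
  · exact (measurable_id.const_sub 1).ennreal_ofReal

lemma secondWeight_zero_add {p : ℝ} (hp : p ∈ Set.Icc (0 : ℝ) 1) :
    secondWeight 0 p + secondWeight 1 p = 1 := by
  simp only [secondWeight]
  rw [if_pos (by simp), if_neg (by simp), ← ENNReal.ofReal_add hp.1 (sub_nonneg.2 hp.2)]
  simp

lemma secondWeight_le_one {p : ℝ} (hp : p ∈ Set.Icc (0 : ℝ) 1) (δ : Fin 2) :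
    secondWeight δ p ≤ 1 := by
  rw [← secondWeight_zero_add hp]
  fin_cases δ
  exacts [le_self_add, le_add_self]

lemma twoParWt_mul {η : ℝ≥0∞} {p : ℝ} (hp : p ∈ Set.Icc (0 : ℝ) 1) (s : ℕ) (v : Fin (s + 2 + 1)) :
    twoParWt η p (s + 2) v * (1 + s * toSimplex (η, p) 0 : ℝ≥0)
      = toSimplex (η, p) (rankLetter (s + 2) v) := by
  have hs : s + 2 - 1 = s + 1 := rfl
  simp only [twoParWt, rankLetter]
  rw [if_neg (by omega), if_neg (by omega), hs, ofReal_eq_unitClip hp,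
    ofReal_one_sub_eq_unitClip hp]
  by_cases h0 : η = 0
  · subst h0
    have hm : middleWeight 0 = 1 := by simp [middleWeight]
    rw [if_pos rfl]
    split_ifs with h1 h2 h3 h2 h3
    · simp [toSimplex_one, hm]
    · simp [toSimplex_two, hm]
    · omega
    · omega
    · omega
    · rw [toSimplex_zero, hm, mul_one, add_comm (1 : ℝ≥0), one_div]
      push_cast
      exact ENNReal.inv_mul_cancel (by simp) (by finiteness)
  rw [if_neg h0]
  by_cases ht : η = ⊤
  · subst ht
    have hm : middleWeight ⊤ = 0 := by simp [middleWeight]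
    rw [if_pos rfl]
    split_ifs <;> simp [toSimplex_zero, toSimplex_one, toSimplex_two, hm]
  rw [if_neg ht]
  lift η to ℝ≥0 using ht
  have hm : middleWeight η = (1 + η)⁻¹ := by
    rw [← ENNReal.coe_inj, coe_middleWeight, ENNReal.coe_inv (by positivity)]
    push_cast
    rfl
  have hm' : 1 - (1 + η)⁻¹ = η / (1 + η) := by
    rw [tsub_eq_iff_eq_add_of_le (inv_le_one_of_one_le₀ le_self_add)]
    field_simp
    rw [add_comm]
  have hd : (η + (s + 1 : ℕ) : ℝ≥0) ≠ 0 := by positivity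
  have hc : (η : ℝ≥0∞) + ((s + 1 : ℕ) : ℝ≥0∞) = ((η + (s + 1 : ℕ) : ℝ≥0) : ℝ≥0∞) := by push_cast; rfl
  rw [hc]
  split_ifs
  · rw [toSimplex_zero, toSimplex_one, hm, hm', ← ENNReal.coe_mul, ← ENNReal.coe_div hd,
      ← ENNReal.coe_mul, ENNReal.coe_inj]
    push_cast
    field_simp
    ring
  · rw [toSimplex_zero, toSimplex_two, hm, hm', ← ENNReal.coe_mul, ← ENNReal.coe_div hd,
      ← ENNReal.coe_mul, ENNReal.coe_inj]
    push_cast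
    field_simp
    ring
  · rw [toSimplex_zero, hm, ← ENNReal.coe_one, ← ENNReal.coe_div hd, ← ENNReal.coe_mul,
      ENNReal.coe_inj]
    push_cast
    field_simp
    ring

lemma prod_twoParWt {q : ℝ≥0∞ × ℝ} (hq : q.2 ∈ Set.Icc (0 : ℝ) 1) (ω : RankSpace) (s : ℕ) :
    ∏ j : Fin (s + 2), twoParWt q.1 q.2 j (ω j)
      = secondWeight (ω 1) q.2 * countWeight (letterCount ω s) (toSimplex q) := by
  rw [Fin.prod_univ_eq_prod_range (fun j => twoParWt q.1 q.2 j (ω j))]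
  induction s with
  | zero =>
    rw [Finset.prod_range_succ, Finset.prod_range_one]
    simp [twoParWt, secondWeight]
  | succ s ih =>
    rw [Finset.prod_range_succ, ih, letterCount_succ, mul_assoc]
    congr 1
    have h1 := twoParWt_mul (η := q.1) hq s (ω (s + 2))
    have h2 := countWeight_add_single_mul (letterCount ω s) (rankLetter (s + 2) (ω (s + 2)))
      (toSimplex q)
    rw [deg_letterCount, ← ENNReal.coe_inj, ENNReal.coe_mul, ENNReal.coe_mul] at h2
    have hne : ((1 + s * toSimplex q 0 : ℝ≥0) : ℝ≥0∞) ≠ 0 := by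
      rw [Ne, ENNReal.coe_eq_zero]; positivity
    rw [← ENNReal.mul_left_inj hne ENNReal.coe_ne_top, h2, mul_assoc, h1, mul_comm]

end Parameters

section Mixture
open NNReal

variable {P : Measure RankSpace}

lemma secondWeight_one_ofSimplex (x : stdSimplex ℝ≥0 (Fin 3)) :
    secondWeight 1 (ofSimplex 1 x).2 = x 2 * (1 - x 0 : ℝ≥0∞)⁻¹ := by
  simp only [secondWeight, ofSimplex]
  rw [if_neg (by simp)]
  have e2 := apply_two_eq x
  split_ifs with h
  · have hd : 1 - x 0 ≠ 0 := (tsub_pos_of_lt h).ne'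
    have hle : x 1 / (1 - x 0) ≤ 1 := div_le_one_of_le₀ (apply_one_le x) zero_le
    rw [← NNReal.coe_one, ← NNReal.coe_sub hle, ENNReal.ofReal_coe_nnreal, ← ENNReal.coe_one,
      ← ENNReal.coe_sub, ← ENNReal.coe_inv hd, ← ENNReal.coe_mul, ENNReal.coe_inj,
      ← div_eq_mul_inv, e2, tsub_div, div_self hd]
  · rw [tsub_eq_zero_of_le (not_lt.1 h), zero_tsub] at e2
    simp [e2]

lemma secondWeight_zero_ofSimplex (x : stdSimplex ℝ≥0 (Fin 3)) :
    secondWeight 0 (ofSimplex 0 x).2 = x 1 * (1 - x 0 : ℝ≥0∞)⁻¹ := by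
  simp only [secondWeight, ofSimplex]
  rw [if_pos (by simp)]
  split_ifs with h
  · have hd : 1 - x 0 ≠ 0 := (tsub_pos_of_lt h).ne'
    rw [ENNReal.ofReal_coe_nnreal, ← ENNReal.coe_one, ← ENNReal.coe_sub, ← ENNReal.coe_inv hd,
      ← ENNReal.coe_mul, div_eq_mul_inv]
  · have e1 := apply_one_le x
    rw [tsub_eq_zero_of_le (not_lt.1 h)] at e1
    simp [le_antisymm e1 zero_le]

lemma ae_mem_Icc_of_extremeParams {ν : Measure (ℝ≥0∞ × ℝ)} (hν : ν extremeParamsᶜ = 0) :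
    ∀ᵐ q ∂ν, q.2 ∈ Set.Icc (0 : ℝ) 1 := by
  filter_upwards [measure_eq_zero_iff_ae_notMem.1 hν] with q hq
  exact (not_not.1 hq).1.2

lemma lintegral_prod_twoParWt {ν : Measure (ℝ≥0∞ × ℝ)} (hν : ν extremeParamsᶜ = 0)
    (ω : RankSpace) (s : ℕ) :
    ∫⁻ q, ∏ j : Fin (s + 2), twoParWt q.1 q.2 j (ω j) ∂ν
      = ∫⁻ q, secondWeight (ω 1) q.2 * countWeight (letterCount ω s) (toSimplex q) ∂ν :=
  lintegral_congr_ae ((ae_mem_Icc_of_extremeParams hν).mono fun _ hq => prod_twoParWt hq ω s)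

/-- The mixing measure on `E` built from the two mixing measures on the simplex. -/
noncomputable def mixingMeasure (ρ : Fin 2 → Measure (stdSimplex ℝ≥0 (Fin 3))) :
    Measure (ℝ≥0∞ × ℝ) :=
  (ρ 0).map (ofSimplex 1) + (ρ 1).map (ofSimplex 0)

lemma measurableSet_extremeParams : MeasurableSet extremeParams :=
  (MeasurableSet.univ.prod measurableSet_Icc).diff
    ((measurableSet_singleton 0).prod measurableSet_Ioo)

lemma mixingMeasure_compl (ρ : Fin 2 → Measure (stdSimplex ℝ≥0 (Fin 3))) :
    mixingMeasure ρ extremeParamsᶜ = 0 := by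
  have hpre : ∀ c : ℝ, c = 0 ∨ c = 1 → ofSimplex c ⁻¹' extremeParamsᶜ = ∅ := fun c hc =>
    Set.eq_empty_of_forall_notMem fun x hx => hx (ofSimplex_mem_extremeParams hc x)
  rw [mixingMeasure, Measure.add_apply,
    Measure.map_apply (measurable_ofSimplex _) measurableSet_extremeParams.compl,
    Measure.map_apply (measurable_ofSimplex _) measurableSet_extremeParams.compl,
    hpre 1 (Or.inr rfl), hpre 0 (Or.inl rfl), measure_empty, measure_empty, add_zero]

lemma lintegral_mixingMeasure {ρ : Fin 2 → Measure (stdSimplex ℝ≥0 (Fin 3))}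
    (hρ : (ρ 0).withDensity (fun x => (x 2 : ℝ≥0∞)) = (ρ 1).withDensity fun x => (x 1 : ℝ≥0∞))
    (δ : Fin 2) {g : stdSimplex ℝ≥0 (Fin 3) → ℝ≥0∞} (hg : Measurable g) :
    ∫⁻ q, secondWeight δ q.2 * g (toSimplex q) ∂mixingMeasure ρ = ∫⁻ x, g x ∂ρ δ := by
  have hco := fun i => (measurable_stdSimplex_apply (ι := Fin 3) i).coe_nnreal_ennreal
  have hm : ∀ δ, Measurable fun q : ℝ≥0∞ × ℝ => secondWeight δ q.2 * g (toSimplex q) := fun δ =>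
    ((measurable_secondWeight δ).comp measurable_snd).mul (hg.comp measurable_toSimplex)
  have hw : ∀ (c : ℝ) δ, Measurable fun x => secondWeight δ (ofSimplex c x).2 := fun c δ =>
    (measurable_secondWeight δ).comp (measurable_ofSimplex c).snd
  have hc : ∀ δ, ∫⁻ q, secondWeight δ q.2 * g (toSimplex q) ∂mixingMeasure ρ
      = ∫⁻ x, secondWeight δ (ofSimplex 1 x).2 * g x ∂ρ 0
        + ∫⁻ x, secondWeight δ (ofSimplex 0 x).2 * g x ∂ρ 1 := fun δ => by
    rw [mixingMeasure, lintegral_add_measure, lintegral_map (hm δ) (measurable_ofSimplex _),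
      lintegral_map (hm δ) (measurable_ofSimplex _)]
    simp only [toSimplex_ofSimplex (c := 0) (by simp), toSimplex_ofSimplex (c := 1) (by simp)]
  have cross : ∫⁻ x, secondWeight 1 (ofSimplex 1 x).2 * g x ∂ρ 0
      = ∫⁻ x, secondWeight 0 (ofSimplex 0 x).2 * g x ∂ρ 1 := by
    have hr : Measurable fun x : stdSimplex ℝ≥0 (Fin 3) => (1 - x 0 : ℝ≥0∞)⁻¹ * g x :=
      ((hco 0).const_sub 1).inv.mul hg
    have h := congrArg (fun σ => ∫⁻ x, (1 - x 0 : ℝ≥0∞)⁻¹ * g x ∂σ) hρ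
    rw [lintegral_withDensity_eq_lintegral_mul _ (hco 2) hr,
      lintegral_withDensity_eq_lintegral_mul _ (hco 1) hr] at h
    simpa only [secondWeight_one_ofSimplex, secondWeight_zero_ofSimplex, Pi.mul_apply,
      mul_assoc] using h
  have total : ∀ (c : ℝ), c ∈ Set.Icc (0 : ℝ) 1 → ∀ σ : Measure (stdSimplex ℝ≥0 (Fin 3)),
      ∫⁻ x, secondWeight 0 (ofSimplex c x).2 * g x ∂σ
        + ∫⁻ x, secondWeight 1 (ofSimplex c x).2 * g x ∂σ = ∫⁻ x, g x ∂σ := fun c hc σ => by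
    have hm0 : Measurable fun x => secondWeight 0 (ofSimplex c x).2 * g x := (hw c 0).mul hg
    rw [← lintegral_add_left hm0]
    refine lintegral_congr fun x => ?_
    rw [← add_mul, secondWeight_zero_add (ofSimplex_snd_mem hc x), one_mul]
  rw [hc]
  fin_cases δ
  · exact (congrArg _ cross.symm).trans (total 1 (by simp) (ρ 0))
  · exact (congrArg (· + _) cross).trans (total 0 (by simp) (ρ 1))

lemma eq_mixingMeasure {ν : Measure (ℝ≥0∞ × ℝ)} [IsFiniteMeasure ν] (hν : ν extremeParamsᶜ = 0)
    {ρ : Fin 2 → Measure (stdSimplex ℝ≥0 (Fin 3))} [∀ δ, IsFiniteMeasure (ρ δ)]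
    (h : ∀ δ β, ∫⁻ q, secondWeight δ q.2 * countWeight β (toSimplex q) ∂ν
      = ∫⁻ x, countWeight β x ∂ρ δ) : ν = mixingMeasure ρ := by
  have hI := ae_mem_Icc_of_extremeParams hν
  have hw : ∀ δ, Measurable fun q : ℝ≥0∞ × ℝ => secondWeight δ q.2 := fun δ =>
    (measurable_secondWeight δ).comp measurable_snd
  have hmap : ∀ δ, (ν.withDensity fun q => secondWeight δ q.2).map toSimplex = ρ δ := fun δ => by
    have : IsFiniteMeasure (ν.withDensity fun q => secondWeight δ q.2) :=
      isFiniteMeasure_withDensity (ne_top_of_le_ne_top (measure_ne_top ν Set.univ) (by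
        rw [← lintegral_one]
        exact lintegral_mono_ae (hI.mono fun q hq => secondWeight_le_one hq δ)))
    refine ext_of_lintegral_countWeight fun β => ?_
    have hβ := (measurable_countWeight β).coe_nnreal_ennreal
    have hβ' : Measurable fun q => (countWeight β (toSimplex q) : ℝ≥0∞) :=
      hβ.comp measurable_toSimplex
    rw [lintegral_map hβ measurable_toSimplex,
      lintegral_withDensity_eq_lintegral_mul _ (hw δ) hβ']
    exact h δ β
  have hback : ∀ (δ : Fin 2) (c : ℝ),
      (∀ q ∈ extremeParams, secondWeight δ q.2 ≠ 0 → q.1 ≠ 0 ∨ q.2 = c) →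
      (ρ δ).map (ofSimplex c) = ν.withDensity fun q => secondWeight δ q.2 := fun δ c hc => by
    rw [← hmap δ, Measure.map_map (measurable_ofSimplex c) measurable_toSimplex]
    refine (Measure.map_congr ?_).trans Measure.map_id
    refine (ae_withDensity_iff (hw δ)).2 ?_
    filter_upwards [measure_eq_zero_iff_ae_notMem.1 hν] with q hq hne
    have hq := not_not.1 hq
    exact ofSimplex_toSimplex hq.1.2 (hc q hq hne)
  have endpoint : ∀ q ∈ extremeParams, q.1 ≠ 0 ∨ q.2 = 0 ∨ q.2 = 1 := fun q hq => by
    by_contra! hcon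
    exact hq.2 ⟨hcon.1, lt_of_le_of_ne hq.1.2.1 hcon.2.1.symm, lt_of_le_of_ne hq.1.2.2 hcon.2.2⟩
  rw [mixingMeasure, hback 0 1, hback 1 0, ← withDensity_add_left (hw 0)]
  · refine (withDensity_one.symm.trans (withDensity_congr_ae ?_))
    exact hI.mono fun q hq => (secondWeight_zero_add hq).symm
  · intro q hq hne
    refine (endpoint q hq).imp_right fun h => h.resolve_right fun h1 => hne ?_
    simp [secondWeight, h1]
  · intro q hq hne
    refine (endpoint q hq).imp_right fun h => h.resolve_left fun h1 => hne ?_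
    simp [secondWeight, h1]

lemma exists_prefixCyl_eq {n : ℕ} (i : (j : Fin n) → Fin (j.val + 1)) :
    ∃ ω : RankSpace, (∀ j : Fin n, ω j = i j) ∧ rankCyl i = prefixCyl ω n := by
  refine ⟨fun j => if h : j < n then i ⟨j, h⟩ else 0, fun j => by simp, ?_⟩
  simp [prefixCyl, rankCyl]

lemma rankCyl_eq_univ {n : ℕ} (hn : n < 2) (i : (j : Fin n) → Fin (j.val + 1)) :
    rankCyl i = Set.univ := by
  refine Set.eq_univ_of_forall fun ω j => ?_
  have h1 := (ω j).isLt
  have h2 := (i j).isLt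
  have h3 := j.isLt
  exact Fin.ext (by omega)

lemma prod_twoParWt_eq_one {n : ℕ} (hn : n < 2) (i : (j : Fin n) → Fin (j.val + 1))
    (q : ℝ≥0∞ × ℝ) : ∏ j : Fin n, twoParWt q.1 q.2 j.val (i j) = 1 :=
  Finset.prod_eq_one fun j _ => if_pos (by omega)

lemma IsRecordUniform.exists_measure [IsProbabilityMeasure P] (hP : IsRecordUniform P) :
    ∃ ρ : Fin 2 → Measure (stdSimplex ℝ≥0 (Fin 3)), (∀ δ, IsFiniteMeasure (ρ δ)) ∧
      (∀ δ β, cylArray P δ β = ∫⁻ x, countWeight β x ∂ρ δ) ∧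
      (ρ 0).withDensity (fun x => (x 2 : ℝ≥0∞)) = (ρ 1).withDensity fun x => (x 1 : ℝ≥0∞) := by
  choose ρ hfin hρ using fun δ => (hP.isHarmonic_cylArray δ).exists_measure
  refine ⟨ρ, hfin, hρ, ?_⟩
  have hco := fun i => (measurable_stdSimplex_apply (ι := Fin 3) i).coe_nnreal_ennreal
  have hfin' : ∀ δ (i : Fin 3), IsFiniteMeasure ((ρ δ).withDensity fun x => (x i : ℝ≥0∞)) :=
    fun δ i => isFiniteMeasure_withDensity
      (IsFiniteMeasure.lintegral_lt_top_of_bounded_to_ennreal _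
        ⟨1, fun x => by exact_mod_cast stdSimplex.le_one x i⟩).ne
  have hmix : ∀ δ, mixWeight (ρ δ) (fun _ => 1) = cylArray P δ := fun δ => by
    funext β
    simp [mixWeight, hρ]
  have key : ∀ δ (i : Fin 3) β, ∫⁻ x, countWeight β x ∂(ρ δ).withDensity (fun x => (x i : ℝ≥0∞))
      = nextLetter i (cylArray P δ) β := fun δ i β => by
    rw [← hmix, nextLetter_mixWeight _ measurable_const, lintegral_withDensity_eq_lintegral_mul _
      (hco i) (measurable_countWeight β).coe_nnreal_ennreal]
    simp [mixWeight]
  refine ext_of_lintegral_countWeight fun β => ?_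
  rw [key, key]
  simp only [nextLetter, add_right_comm β _ (_ • _), hP.cylArray_zero_add]

end Mixture

/-- if each cylinder probability depends only on the pair of record
counts `(#{2 ≤ j ≤ n : i_j = 1}, #{2 ≤ j ≤ n : i_j = j})`, then `P` is a unique mixture
over `E` of the two-parameter laws `M^{(η,p)}`. -/
theorem stmt_15 (P : Measure RankSpace) [IsProbabilityMeasure P]
    (hP : ∀ (n : ℕ) (i i' : (j : Fin n) → Fin (j.val + 1)),
      (Finset.univ.filter fun j : Fin n => 1 ≤ j.val ∧ (i j).val = 0).card
        = (Finset.univ.filter fun j : Fin n => 1 ≤ j.val ∧ (i' j).val = 0).card →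
      (Finset.univ.filter fun j : Fin n => 1 ≤ j.val ∧ (i j).val = j.val).card
        = (Finset.univ.filter fun j : Fin n => 1 ≤ j.val ∧ (i' j).val = j.val).card →
      P (rankCyl i) = P (rankCyl i')) :
    ∃! ν : Measure (ℝ≥0∞ × ℝ), IsProbabilityMeasure ν ∧ ν extremeParamsᶜ = 0 ∧
      ∀ (n : ℕ) (i : (j : Fin n) → Fin (j.val + 1)),
        P (rankCyl i) = ∫⁻ q, ∏ j : Fin n, twoParWt q.1 q.2 j.val (i j) ∂ν := by
  have hP : IsRecordUniform P := hP
  obtain ⟨ρ, hfin, hρ, hrel⟩ := hP.exists_measure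
  have hE := mixingMeasure_compl ρ
  have huniv : mixingMeasure ρ Set.univ = 1 := by
    rw [← hP.cylArray_zero_zero, mixingMeasure, Measure.add_apply,
      Measure.map_apply (measurable_ofSimplex _) MeasurableSet.univ,
      Measure.map_apply (measurable_ofSimplex _) MeasurableSet.univ, hρ, hρ]
    simp
  refine ⟨mixingMeasure ρ, ⟨⟨huniv⟩, hE, fun n i => ?_⟩, ?_⟩
  · rcases lt_or_ge n 2 with hn | hn
    · simp [rankCyl_eq_univ hn, prod_twoParWt_eq_one hn, huniv]
    · obtain ⟨s, rfl⟩ := Nat.exists_eq_add_of_le' hn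
      obtain ⟨ω, hω, hi⟩ := exists_prefixCyl_eq i
      simp only [← hω]
      rw [lintegral_prod_twoParWt hE, lintegral_mixingMeasure hrel _
        (measurable_countWeight _).coe_nnreal_ennreal, ← hρ, ← hP.measure_prefixCyl, hi]
  · rintro ν ⟨hprob, hν, hcyl⟩
    refine eq_mixingMeasure hν fun δ β => ?_
    obtain ⟨ω, rfl, h⟩ := exists_letterCount_eq δ β
    have h1 := hcyl (deg β + 2) fun j => ω j
    rw [lintegral_prod_twoParWt hν, h] at h1
    rw [← h1, ← hρ, ← h]
    have h2 := hP.measure_prefixCyl ω (deg β)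
    rw [h] at h2 ⊢
    exact h2
end
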